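/- Let (A_S,S) be an Artin-Tits system of spherical type and X ⊆ S. Then the set H_X = {g ∈ A_S : g = g₁g₂⁻¹ where g₁ and g₂ are two X-reduced positive X-ribbons-X} is a subgroup of A_S. -/

import Mathlib

/-!
Common definitions for formalizing "Normalisateur des sous-groupes paraboliques
des groupes d'Artin-Tits" (E. Godelle).

We fix a Coxeter matrix `M` over a finite index set `B` (Mathlib's convention:
`M s t = 0` encodes `m_{s,t} = ∞`).  The Artin-Tits group `Artin M` is the
presented group on the braid relations, the Coxeter group is Mathlib's
`M.Group`, and `proj : Artin M →* M.Group` is the canonical projection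
(adding the relations `s² = 1`).
-/

namespace ArtinTitsPaper

open List

variable {B : Type*}

/-- The alternating list `[s, t, s, t, ...]` with `n` terms, starting with `s`. -/
def altList (s t : B) : ℕ → List B
  | 0 => []
  | n + 1 => s :: altList t s n

/-- The braid relators `(sts⋯)(tst⋯)⁻¹` (`m_{s,t}` letters each) for `s ≠ t`,
`m_{s,t} ≠ ∞`. -/
def braidRels (M : CoxeterMatrix B) : Set (FreeGroup B) :=
  { r | ∃ s t : B, s ≠ t ∧ M s t ≠ 0 ∧
      r = ((altList s t (M s t)).map FreeGroup.of).prod *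
          (((altList t s (M s t)).map FreeGroup.of).prod)⁻¹ }

/-- The Artin-Tits group associated to the Coxeter matrix `M`. -/
def Artin (M : CoxeterMatrix B) : Type _ := PresentedGroup (braidRels M)

instance (M : CoxeterMatrix B) : Group (Artin M) :=
  QuotientGroup.Quotient.group _

/-- The standard generator of `Artin M` indexed by `s : B` (the image of `S` in `A_S`). -/
def gen (M : CoxeterMatrix B) (s : B) : Artin M := PresentedGroup.of s

theorem altList_eq_reverse_alternatingWord (s t : B) (n : ℕ) :
    altList s t n = (CoxeterSystem.alternatingWord t s n).reverse := by
  induction n generalizing s t with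
  | zero => rfl
  | succ n ih =>
      rw [altList, CoxeterSystem.alternatingWord_succ, List.concat_eq_append,
        List.reverse_append]
      simp [ih]

theorem lift_simple_listProd (M : CoxeterMatrix B) (l : List B) :
    FreeGroup.lift M.simple ((l.map FreeGroup.of).prod) =
      M.toCoxeterSystem.wordProd l := by
  rw [CoxeterSystem.wordProd, map_list_prod, List.map_map]
  simp [Function.comp_def, CoxeterMatrix.toCoxeterSystem_simple]

theorem braid_lift (M : CoxeterMatrix B) :
    ∀ r ∈ braidRels M, FreeGroup.lift M.simple r = 1 := by
  rintro r ⟨s, t, hst, hm, rfl⟩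
  rw [map_mul, map_inv, lift_simple_listProd, lift_simple_listProd,
    altList_eq_reverse_alternatingWord, altList_eq_reverse_alternatingWord,
    CoxeterSystem.wordProd_reverse, CoxeterSystem.wordProd_reverse]
  have hsym : M s t = M t s := M.symmetric s t
  have hb := M.toCoxeterSystem.wordProd_braidWord_eq t s
  rw [CoxeterSystem.braidWord, CoxeterSystem.braidWord, ← hsym] at hb
  rw [hb]
  simp

/-- The canonical projection from the Artin-Tits group onto the Coxeter group
(adding the relations `s² = 1`). -/
def proj (M : CoxeterMatrix B) : Artin M →* M.Group :=
  PresentedGroup.toGroup (braid_lift M)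

/-- The positive monoid `A_S⁺`, the submonoid of `A_S` generated by `S`. -/
def posMon (M : CoxeterMatrix B) : Submonoid (Artin M) :=
  Submonoid.closure (Set.range (gen M))

/-- The submonoid `A_X⁺` of `A_S` generated by `X ⊆ S`. -/
def posMonOn (M : CoxeterMatrix B) (X : Set B) : Submonoid (Artin M) :=
  Submonoid.closure (gen M '' X)

/-- The standard parabolic subgroup `A_X` of `A_S` generated by `X ⊆ S`. -/
def stdSub (M : CoxeterMatrix B) (X : Set B) : Subgroup (Artin M) :=
  Subgroup.closure (gen M '' X)

/-- The standard parabolic subgroup `W_X` of the Coxeter group `W_S`. -/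
def coxSub (M : CoxeterMatrix B) (X : Set B) : Subgroup M.Group :=
  Subgroup.closure (M.simple '' X)

/-- `X ⊆ S` is of spherical type if the Coxeter group `W_X` is finite. -/
def IsSpherical (M : CoxeterMatrix B) (X : Set B) : Prop :=
  Finite (coxSub M X)

/-- `a` left-divides `b` in the positive monoid: `b = a c` with `c ∈ A_S⁺`. -/
def ldvd (M : CoxeterMatrix B) (a b : Artin M) : Prop :=
  ∃ c ∈ posMon M, a * c = b

/-- `a` right-divides `b` in the positive monoid: `b = c a` with `c ∈ A_S⁺`. -/
def rdvd (M : CoxeterMatrix B) (a b : Artin M) : Prop :=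
  ∃ c ∈ posMon M, c * a = b

/-- `d` is the least common multiple `Δ_X` of `X` in `A_X⁺` (for left-divisibility). -/
def IsDelta (M : CoxeterMatrix B) (X : Set B) (d : Artin M) : Prop :=
  d ∈ posMonOn M X ∧
  (∀ s ∈ X, ∃ c ∈ posMonOn M X, gen M s * c = d) ∧
  ∀ m ∈ posMonOn M X, (∀ s ∈ X, ∃ c ∈ posMonOn M X, gen M s * c = m) →
    ∃ c ∈ posMonOn M X, d * c = m

/-- The subset `Xg = {σ_x g : x ∈ X}` of `A_S`. -/
def leftMul (M : CoxeterMatrix B) (X : Set B) (g : Artin M) : Set (Artin M) :=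
  (fun x => gen M x * g) '' X

/-- The subset `gX = {g σ_x : x ∈ X}` of `A_S`. -/
def rightMul (M : CoxeterMatrix B) (X : Set B) (g : Artin M) : Set (Artin M) :=
  (fun x => g * gen M x) '' X

/-- `Conj(S;X,Y) = {g ∈ A_S : gX = Yg}`. -/
def conjSet (M : CoxeterMatrix B) (X Y : Set B) : Set (Artin M) :=
  { g | rightMul M X g = leftMul M Y g }

/-- `Conj⁺(S;X,Y) = {g ∈ A_S⁺ : gX = Yg}`. -/
def conjPos (M : CoxeterMatrix B) (X Y : Set B) : Set (Artin M) :=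
  { g | g ∈ posMon M ∧ rightMul M X g = leftMul M Y g }

/-- The quasi-centralizer `QZ_{A_S}(A_X) = {g ∈ A_S : gX = Xg}`. -/
def QZset (M : CoxeterMatrix B) (X : Set B) : Set (Artin M) :=
  conjSet M X X

/-- The indecomposable component of `Z` containing `t` (vertices of `Z` joined to `t`
by a path of edges `m_{a,b} ≠ 2` in the Coxeter diagram on `Z`). -/
def comp (M : CoxeterMatrix B) (Z : Set B) (t : B) : Set B :=
  { s ∈ Z | Relation.ReflTransGen (fun a b => a ∈ Z ∧ b ∈ Z ∧ a ≠ b ∧ M a b ≠ 2) t s }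

/-- `Z` is indecomposable: it admits no nontrivial partition `Z = Z₁ ∪ Z₂` with
`m_{a,b} = 2` for `a ∈ Z₁`, `b ∈ Z₂`. -/
def Indecomp (M : CoxeterMatrix B) (Z : Set B) : Prop :=
  ¬ ∃ Z₁ Z₂ : Set B, Z₁.Nonempty ∧ Z₂.Nonempty ∧ Z₁ ∪ Z₂ = Z ∧ Disjoint Z₁ Z₂ ∧
      ∀ a ∈ Z₁, ∀ b ∈ Z₂, M a b = 2

/-- `g` is an elementary positive `Y`-ribbon-`X`: `g = d_{X,t}` for some `t ∈ S` with
`X(t)` of spherical type, where `d_{X,t} = Δ_{X(t)}` if `t ∈ X` and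
`d_{X,t} = Δ_{X(t)} Δ_{X(t)∖{t}}⁻¹` otherwise, and `Y ⊆ X ∪ {t}` satisfies `Yg = gX`. -/
def IsElemRibbon (M : CoxeterMatrix B) (X Y : Set B) (g : Artin M) : Prop :=
  ∃ t : B, IsSpherical M (comp M (X ∪ {t}) t) ∧
    ((t ∈ X ∧ IsDelta M (comp M (X ∪ {t}) t) g) ∨
      (t ∉ X ∧ ∃ d₁ d₂ : Artin M, IsDelta M (comp M (X ∪ {t}) t) d₁ ∧
        IsDelta M ((comp M (X ∪ {t}) t) \ {t}) d₂ ∧ g = d₁ * d₂⁻¹)) ∧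
    Y ⊆ X ∪ {t} ∧ leftMul M Y g = rightMul M X g

/-- `g` is a positive `Y`-ribbon-`X`: a product `g = g_n ⋯ g_1` of elementary positive
`X_i`-ribbons-`X_{i-1}` with `X_0 = X`, `X_n = Y`. -/
inductive IsRibbon (M : CoxeterMatrix B) : Set B → Set B → Artin M → Prop
  | nil (X : Set B) : IsRibbon M X X 1
  | cons {X Y Z : Set B} {g h : Artin M} :
      IsRibbon M X Y g → IsElemRibbon M Y Z h → IsRibbon M X Z (h * g)

/-- `g` is `X`-reduced: no element of `X` left-divides `g`. -/
def lreduced (M : CoxeterMatrix B) (X : Set B) (g : Artin M) : Prop :=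
  ∀ s ∈ X, ¬ ldvd M (gen M s) g

/-- `g` is reduced-`X`: no element of `X` right-divides `g`. -/
def rreduced (M : CoxeterMatrix B) (X : Set B) (g : Artin M) : Prop :=
  ∀ s ∈ X, ¬ rdvd M (gen M s) g

/-- The set `H_X` of elements `g₁ g₂⁻¹` where `g₁, g₂` are `X`-reduced positive
`X`-ribbons-`X`. -/
def HXset (M : CoxeterMatrix B) (X : Set B) : Set (Artin M) :=
  { g | ∃ g₁ g₂ : Artin M, IsRibbon M X X g₁ ∧ lreduced M X g₁ ∧
      IsRibbon M X X g₂ ∧ lreduced M X g₂ ∧ g = g₁ * g₂⁻¹ }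

/-- The length of a positive element (the common length of its expressions as words
in the generators; junk value `0` outside of `A_S⁺`). -/
noncomputable def len (M : CoxeterMatrix B) (g : Artin M) : ℕ :=
  sInf { n | ∃ l : List B, l.length = n ∧ (l.map (gen M)).prod = g }

/-- The length of an element of the Coxeter group `W_S`. -/
noncomputable def wlen (M : CoxeterMatrix B) (w : M.Group) : ℕ :=
  sInf { n | ∃ l : List B, l.length = n ∧ (l.map M.simple).prod = w }

/-- `g ∈ A_{S,red}`: `g` is positive and has the same length as its image in `W_S`. -/
def Red (M : CoxeterMatrix B) (g : Artin M) : Prop :=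
  g ∈ posMon M ∧ len M g = wlen M (proj M g)

/-- `C` is a simple `s`-chain-`u`: either `C = 1` and `s = u`, or
`C = tst⋯` (`k` letters, `k < m_{s,t}`) with `u ∈ {s,t}` and `C·u = tst⋯` (`k+1` letters). -/
def IsSimpleChain (M : CoxeterMatrix B) (s u : B) (C : Artin M) : Prop :=
  (C = 1 ∧ s = u) ∨
  ∃ t : B, t ≠ s ∧ (u = s ∨ u = t) ∧ ∃ k : ℕ,
    (M s t = 0 ∨ k < M s t) ∧
    C = ((altList t s k).map (gen M)).prod ∧
    C * gen M u = ((altList t s (k + 1)).map (gen M)).prod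

/-- `C` is an `s`-chain-`t`: a product `C₁ ⋯ C_k` of simple chains composing from
origin `s` to target `t`. -/
inductive IsChain (M : CoxeterMatrix B) : B → B → Artin M → Prop
  | single {s u : B} {C : Artin M} : IsSimpleChain M s u C → IsChain M s u C
  | comp {s u v : B} {C D : Artin M} :
      IsChain M s u C → IsSimpleChain M u v D → IsChain M s v (C * D)

section Coxeter

variable {W : Type*} [Group W] {M : CoxeterMatrix B} (cs : CoxeterSystem M W)

section Exchange

open Classical in
/-- The action of a simple reflection on pairs (group element, sign), which records the
parity of the number of occurrences of an element in an inversion sequence. -/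
noncomputable def parityStep (i : B) : Function.End (W × ZMod 2) :=
  fun p => (cs.simple i * p.1 * cs.simple i, p.2 + if p.1 = cs.simple i then 1 else 0)

open Classical in
theorem parityStep_mul_pow_apply (i j : B) (n : ℕ) (t : W) (e : ZMod 2) :
    ((parityStep cs i * parityStep cs j) ^ n) (t, e) =
      ((cs.simple i * cs.simple j) ^ n * t * ((cs.simple i * cs.simple j) ^ n)⁻¹,
        e + ∑ k ∈ Finset.range (2 * n),
          if t = ((cs.simple i * cs.simple j) ^ k)⁻¹ * cs.simple j then 1 else 0) := by
  induction n with
  | zero =>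
    simp only [pow_zero, one_mul, inv_one, mul_one, mul_zero, Finset.range_zero,
      Finset.sum_empty, add_zero]
    rfl
  | succ n ih =>
    set r := cs.simple i * cs.simple j with hr
    have hrj : r⁻¹ = cs.simple j * cs.simple i := by simp [hr]
    have hconj : cs.simple j * r = r⁻¹ * cs.simple j := by rw [hrj, hr, mul_assoc]
    have hpow : ∀ k : ℕ, cs.simple j * r ^ k = (r ^ k)⁻¹ * cs.simple j := by
      intro k
      have : SemiconjBy (cs.simple j) r r⁻¹ := hconj
      have := this.pow_right k
      rw [inv_pow] at this
      exact this
    rw [pow_succ']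
    change (parityStep cs i) ((parityStep cs j) (((parityStep cs i * parityStep cs j) ^ n) (t, e)))
      = _
    rw [ih]
    simp only [parityStep]
    have h1 : (r ^ n * t * (r ^ n)⁻¹ = cs.simple j) ↔ t = (r ^ (2 * n))⁻¹ * cs.simple j := by
      rw [mul_inv_eq_iff_eq_mul, hpow, ← eq_inv_mul_iff_mul_eq, ← mul_assoc, two_mul, pow_add,
        mul_inv_rev]
    have h2 : (cs.simple j * (r ^ n * t * (r ^ n)⁻¹) * cs.simple j = cs.simple i) ↔
        t = (r ^ (2 * n + 1))⁻¹ * cs.simple j := by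
      have hr2 : (r ^ (2 * n + 1))⁻¹ * cs.simple j =
          (r ^ n)⁻¹ * (cs.simple j * cs.simple i * cs.simple j) * r ^ n := by
        have : r ^ (2 * n + 1) = r ^ n * r * r ^ n := by
          rw [two_mul, add_right_comm, pow_add, pow_succ]
        rw [this, mul_inv_rev, mul_inv_rev, mul_assoc, mul_assoc, ← hpow, hrj]
        simp only [mul_assoc]
      rw [hr2]
      constructor
      · intro h
        rw [← h]
        simp [mul_assoc]
      · rintro rfl
        simp [mul_assoc]
    rw [show 2 * (n + 1) = 2 * n + 1 + 1 by ring, Finset.sum_range_succ, Finset.sum_range_succ]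
    simp only [h1, h2]
    refine Prod.ext ?_ ?_
    · simp only [hr, pow_succ', mul_inv_rev, cs.inv_simple, mul_assoc]
    · simp only [add_assoc]

theorem parityStep_isLiftable : M.IsLiftable (parityStep cs) := by
  classical
  intro i j
  funext ⟨t, e⟩
  rw [parityStep_mul_pow_apply, cs.simple_mul_simple_pow]
  have : ∀ k, (cs.simple i * cs.simple j) ^ (M i j + k) = (cs.simple i * cs.simple j) ^ k := by
    intro k; rw [pow_add, cs.simple_mul_simple_pow, one_mul]
  rw [two_mul, Finset.sum_range_add]
  simp only [this]
  simp only [one_mul, inv_one, mul_one, CharTwo.add_self_eq_zero, add_zero]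
  rfl

open Classical in
theorem lift_parityStep_wordProd (ω : List B) (t : W) (e : ZMod 2) :
    cs.lift ⟨parityStep cs, parityStep_isLiftable cs⟩ (cs.wordProd ω) (t, e) =
      (cs.wordProd ω * t * (cs.wordProd ω)⁻¹, e + ((cs.rightInvSeq ω).count t : ZMod 2)) := by
  induction ω with
  | nil => simp only [cs.wordProd_nil, map_one]; simp; rfl
  | cons i ω ih =>
    rw [cs.wordProd_cons, map_mul]
    rw [cs.lift_apply_simple]
    change parityStep cs i (cs.lift ⟨parityStep cs, parityStep_isLiftable cs⟩ (cs.wordProd ω) (t, e)) = _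
    rw [ih]
    simp only [parityStep, CoxeterSystem.rightInvSeq, List.count_cons, beq_iff_eq]
    have : cs.wordProd ω * t * (cs.wordProd ω)⁻¹ = cs.simple i ↔
        (cs.wordProd ω)⁻¹ * cs.simple i * cs.wordProd ω = t := by
      rw [mul_inv_eq_iff_eq_mul, mul_assoc, inv_mul_eq_iff_eq_mul, eq_comm]
    refine Prod.ext ?_ ?_
    · simp [mul_assoc]
    · simp only [this]
      push_cast
      rw [add_assoc]

open Classical in
theorem count_leftInvSeq_eq_of_wordProd_eq {ω ω' : List B} (h : cs.wordProd ω = cs.wordProd ω')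
    (t : W) : ((cs.leftInvSeq ω).count t : ZMod 2) = (cs.leftInvSeq ω').count t := by
  have key : ∀ ω : List B, (cs.leftInvSeq ω).count t = (cs.rightInvSeq ω.reverse).count t := by
    intro ω
    rw [cs.rightInvSeq_reverse, List.count_reverse]
  rw [key, key]
  have h1 := lift_parityStep_wordProd cs ω.reverse t 0
  have h2 := lift_parityStep_wordProd cs ω'.reverse t 0
  rw [cs.wordProd_reverse] at h1 h2
  rw [h, h2] at h1
  have := congrArg Prod.snd h1
  simpa using this.symm

theorem simple_mem_leftInvSeq {ω : List B} {i : B}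
    (hd : cs.IsLeftDescent (cs.wordProd ω) i) : cs.simple i ∈ cs.leftInvSeq ω := by
  classical
  obtain ⟨ω', hred, hω'⟩ := cs.exists_isReduced (cs.simple i * cs.wordProd ω)
  have hprod : cs.wordProd ω = cs.wordProd (i :: ω') := by
    rw [cs.wordProd_cons, ← hω']; simp
  have hnot : cs.simple i ∉ cs.leftInvSeq ω' := by
    intro hmem
    have := cs.isLeftInversion_of_mem_leftInvSeq hred hmem
    have h2 := this.2
    rw [← hω'] at h2
    rw [cs.simple_mul_simple_cancel_left] at h2
    have : cs.length (cs.simple i * cs.wordProd ω) < cs.length (cs.wordProd ω) := hd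
    omega
  have hc := count_leftInvSeq_eq_of_wordProd_eq cs hprod (cs.simple i)
  have hz : (cs.leftInvSeq (i :: ω')).count (cs.simple i) = 1 := by
    rw [CoxeterSystem.leftInvSeq, List.count_cons_self]
    rw [List.count_eq_zero.2]
    intro hmem
    obtain ⟨x, hx, hxe⟩ := List.mem_map.1 hmem
    have hh : x = cs.simple i :=
      (MulAut.conj (cs.simple i)).injective (hxe.trans (by simp))
    exact hnot (hh ▸ hx)
  rw [hz] at hc
  by_contra hne
  rw [List.count_eq_zero.2 hne] at hc
  simp at hc

theorem exists_eraseIdx_of_isLeftDescent {ω : List B} {i : B}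
    (hd : cs.IsLeftDescent (cs.wordProd ω) i) :
    ∃ j < ω.length, cs.simple i * cs.wordProd ω = cs.wordProd (ω.eraseIdx j) := by
  obtain ⟨j, hj, he⟩ := List.getElem_of_mem (simple_mem_leftInvSeq cs hd)
  refine ⟨j, by simpa using hj, ?_⟩
  rw [← cs.getD_leftInvSeq_mul_wordProd, List.getD_eq_getElem _ _ hj, he]

end Exchange
end Coxeter

section WeakOrder

variable {W : Type*} [Group W] {M : CoxeterMatrix B} (cs : CoxeterSystem M W)

/-- The weak order on a Coxeter group. -/
def WeakLE (u v : W) : Prop := cs.length u + cs.length (u⁻¹ * v) = cs.length v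

namespace WeakLE

theorem refl (u : W) : WeakLE cs u u := by simp [WeakLE]

theorem one_le (u : W) : WeakLE cs 1 u := by simp [WeakLE]

variable {cs}

theorem of_le {u v : W} (h : cs.length u + cs.length (u⁻¹ * v) ≤ cs.length v) :
    WeakLE cs u v := by
  refine le_antisymm h ?_
  have := cs.length_mul_le u (u⁻¹ * v)
  rwa [mul_inv_cancel_left] at this

theorem mul_left_le {u v a : W} (hu : WeakLE cs u a) (hv : WeakLE cs v (u⁻¹ * a)) :
    WeakLE cs u (u * v) ∧ WeakLE cs (u * v) a := by
  unfold WeakLE at *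
  have h1 := cs.length_mul_le u v
  have h2 := cs.length_mul_le (u * v) ((u * v)⁻¹ * a)
  have h3 : (u * v)⁻¹ * a = v⁻¹ * (u⁻¹ * a) := by group
  rw [mul_inv_cancel_left, h3] at h2
  rw [inv_mul_cancel_left, h3]
  omega

theorem trans {u v w : W} (h : WeakLE cs u v) (h' : WeakLE cs v w) : WeakLE cs u w := by
  apply of_le
  have h1 := cs.length_mul_le (u⁻¹ * v) (v⁻¹ * w)
  have h3 : u⁻¹ * v * (v⁻¹ * w) = u⁻¹ * w := by group
  rw [h3] at h1
  unfold WeakLE at *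
  omega

theorem inv_mul {u x y : W} (h : WeakLE cs u x) (h' : WeakLE cs x y) :
    WeakLE cs (u⁻¹ * x) (u⁻¹ * y) := by
  have h2 := h.trans h'
  unfold WeakLE at *
  have h3 : (u⁻¹ * x)⁻¹ * (u⁻¹ * y) = x⁻¹ * y := by group
  rw [h3]
  omega

theorem antisymm {u v : W} (h : WeakLE cs u v) (h' : WeakLE cs v u) : u = v := by
  unfold WeakLE at *
  have : cs.length (u⁻¹ * v) = 0 := by omega
  rw [cs.length_eq_zero_iff, inv_mul_eq_one] at this
  exact this

theorem length_le {u v : W} (h : WeakLE cs u v) : cs.length u ≤ cs.length v := by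
  unfold WeakLE at h; omega

theorem eq_of_length_le {u v : W} (h : WeakLE cs u v) (hl : cs.length v ≤ cs.length u) :
    u = v := by
  unfold WeakLE at h
  have : cs.length (u⁻¹ * v) = 0 := by omega
  rwa [cs.length_eq_zero_iff, inv_mul_eq_one] at this

theorem mul_right_iff {u v : W} :
    WeakLE cs u (u * v) ↔ cs.length (u * v) = cs.length u + cs.length v := by
  unfold WeakLE
  rw [inv_mul_cancel_left, eq_comm]

theorem simple_iff {i : B} {w : W} :
    WeakLE cs (cs.simple i) w ↔ cs.IsLeftDescent w i := by
  rw [cs.isLeftDescent_iff, WeakLE, cs.length_simple, cs.inv_simple, add_comm]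

/-- Exchange property: `s` and `v` below `w`, with `s v` longer than `v`, imply `s v` below `w`. -/
theorem simple_mul {i : B} {v w : W} (hs : WeakLE cs (cs.simple i) w) (hv : WeakLE cs v w)
    (hl : cs.length v < cs.length (cs.simple i * v)) : WeakLE cs (cs.simple i * v) w := by
  obtain ⟨ωv, hωv, hv'⟩ := cs.exists_isReduced v
  obtain ⟨ωu, hωu, hu'⟩ := cs.exists_isReduced (v⁻¹ * w)
  have hw : cs.wordProd (ωv ++ ωu) = w := by
    rw [cs.wordProd_append, ← hv', ← hu', mul_inv_cancel_left]
  have hd : cs.IsLeftDescent (cs.wordProd (ωv ++ ωu)) i := by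
    rw [hw]; exact simple_iff.1 hs
  obtain ⟨j, hj, he⟩ := exists_eraseIdx_of_isLeftDescent cs hd
  have hlv : cs.length v = ωv.length := by rw [hv', hωv]
  have hlu : cs.length (v⁻¹ * w) = ωu.length := by rw [hu', hωu]
  rw [hw] at he
  rw [List.length_append] at hj
  rcases lt_or_ge j ωv.length with h | h
  · rw [List.eraseIdx_append_of_lt_length h, cs.wordProd_append, ← hu'] at he
    have h1 : cs.simple i * v = cs.wordProd (ωv.eraseIdx j) := by
      have := congrArg (· * (v⁻¹ * w)⁻¹) he
      simpa [mul_assoc] using this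
    have h2 := cs.length_wordProd_le (ωv.eraseIdx j)
    rw [← h1, List.length_eraseIdx_of_lt h] at h2
    omega
  · rw [List.eraseIdx_append_of_length_le h, cs.wordProd_append, ← hv'] at he
    have h1 : (cs.simple i * v)⁻¹ * w = cs.wordProd (ωu.eraseIdx (j - ωv.length)) := by
      rw [mul_inv_rev, cs.inv_simple, mul_assoc, he, inv_mul_cancel_left]
    have h2 := cs.length_wordProd_le (ωu.eraseIdx (j - ωv.length))
    rw [← h1, List.length_eraseIdx_of_lt (by omega)] at h2
    apply of_le
    have h3 := cs.length_simple_mul v i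
    unfold WeakLE at hv
    omega

end WeakLE

end WeakOrder

section Order

variable (M : CoxeterMatrix B)

end Order

section Order

variable (M : CoxeterMatrix B)

/-- The entries of the canonical bilinear form of a Coxeter matrix, normalised to have `2` on
the diagonal. -/
noncomputable def cosEntry (s t : B) : ℝ :=
  if M s t = 0 then -2 else -2 * Real.cos (Real.pi / M s t)

/-- The coroot associated to a generator. -/
noncomputable def coroot (s : B) : Module.Dual ℝ (B →₀ ℝ) :=
  Finsupp.linearCombination ℝ (cosEntry M s)

theorem coroot_single (s t : B) : coroot M s (Finsupp.single t 1) = cosEntry M s t := by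
  simp [coroot]

theorem coroot_single_self (s : B) : coroot M s (Finsupp.single s 1) = 2 := by
  simp [coroot_single, cosEntry]

theorem cosEntry_comm (s t : B) : cosEntry M s t = cosEntry M t s := by
  simp only [cosEntry, M.symmetric s t]

/-- The reflection of the geometric representation associated to a generator. -/
noncomputable def geomReflection (s : B) : (B →₀ ℝ) ≃ₗ[ℝ] (B →₀ ℝ) :=
  Module.reflection (coroot_single_self M s)

theorem cosEntry_mul_sub {s t : B} (h : M s t ≠ 0) :
    cosEntry M s t * cosEntry M t s - 2 = 2 * Real.cos (2 * Real.pi / M s t) := by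
  rw [cosEntry_comm M t s, cosEntry, if_neg h, mul_div_assoc, Real.cos_two_mul]
  ring

theorem sin_two_pi_div_pos {m : ℕ} (h : 3 ≤ m) : 0 < Real.sin (2 * Real.pi / m) := by
  have hm : (3 : ℝ) ≤ m := by exact_mod_cast h
  apply Real.sin_pos_of_pos_of_lt_pi
  · have := Real.pi_pos
    positivity
  · rw [div_lt_iff₀ (by linarith)]
    nlinarith [Real.pi_pos]

open Polynomial.Chebyshev in
theorem chebyshev_S_half_even {k : ℕ} (h : 2 ≤ k) :
    (S ℝ (k - 1)).eval (2 * Real.cos (2 * Real.pi / (2 * k : ℕ))) = 0 := by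
  have h0 := sin_two_pi_div_pos (m := 2 * k) (by omega)
  have h1 := S_two_mul_real_cos (θ := 2 * Real.pi / (2 * k : ℕ)) ((k : ℤ) - 1)
  have : (((k : ℤ) - 1 : ℤ) + 1 : ℝ) * (2 * Real.pi / (2 * k : ℕ)) = Real.pi := by
    have : (k : ℝ) ≠ 0 := by positivity
    push_cast
    field_simp
    ring
  rw [this, Real.sin_pi] at h1
  exact (mul_eq_zero.1 h1).resolve_right h0.ne'

open Polynomial.Chebyshev in
theorem chebyshev_S_half_odd {k : ℕ} (h : 1 ≤ k) :
    (S ℝ k).eval (2 * Real.cos (2 * Real.pi / (2 * k + 1 : ℕ))) +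
      (S ℝ (k - 1)).eval (2 * Real.cos (2 * Real.pi / (2 * k + 1 : ℕ))) = 0 := by
  have h0 := sin_two_pi_div_pos (m := 2 * k + 1) (by omega)
  have h1 := S_two_mul_real_cos (θ := 2 * Real.pi / (2 * k + 1 : ℕ)) ((k : ℤ) - 1)
  have h2 := S_two_mul_real_cos (θ := 2 * Real.pi / (2 * k + 1 : ℕ)) (k : ℤ)
  have : (((k : ℤ)) + 1 : ℝ) * (2 * Real.pi / (2 * k + 1 : ℕ)) =
      2 * Real.pi - (((k : ℤ) - 1 : ℤ) + 1 : ℝ) * (2 * Real.pi / (2 * k + 1 : ℕ)) := by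
    have : (2 * k + 1 : ℝ) ≠ 0 := by positivity
    push_cast
    field_simp
    ring
  rw [this, Real.sin_two_pi_sub, ← h1] at h2
  have h3 := mul_right_cancel₀ h0.ne' (h2.trans (neg_mul _ _).symm)
  rw [h3]
  ring

theorem geomReflection_apply (s : B) (z : B →₀ ℝ) :
    geomReflection M s z = z - coroot M s z • Finsupp.single s 1 :=
  Module.reflection_apply _ _

theorem geomReflection_mul_self (s : B) : geomReflection M s * geomReflection M s = 1 := by
  ext1 z
  exact Module.involutive_reflection (coroot_single_self M s) z

open Polynomial.Chebyshev in
theorem geomReflection_isLiftable : M.IsLiftable (geomReflection M) := by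
  intro s t
  by_cases hst : s = t
  · subst hst
    rw [M.diagonal, pow_one, geomReflection_mul_self]
  by_cases h0 : M s t = 0
  · rw [h0, pow_zero]
  by_cases h2 : M s t = 2
  · have hc : coroot M s (Finsupp.single t 1) = 0 := by
      simp [coroot_single, cosEntry, h2]
    have hc' : coroot M t (Finsupp.single s 1) = 0 := by
      rw [coroot_single, cosEntry_comm, ← coroot_single, hc]
    have hcomm : geomReflection M s * geomReflection M t =
        geomReflection M t * geomReflection M s := by
      ext1 z
      simp only [LinearEquiv.mul_apply, geomReflection_apply, map_sub, map_smul, hc, hc',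
        zero_smul, sub_zero]
      abel
    rw [h2, pow_two, mul_assoc, hcomm, ← mul_assoc (geomReflection M t),
      geomReflection_mul_self, one_mul, geomReflection_mul_self]
  have h1 : M s t ≠ 1 := M.off_diagonal s t hst
  have ht := cosEntry_mul_sub M h0
  ext1 z
  rw [geomReflection, geomReflection, Module.reflection_mul_reflection_pow_apply
    (coroot_single_self M s) (coroot_single_self M t) (M s t) z
    (2 * Real.cos (2 * Real.pi / M s t)) (by rw [coroot_single, coroot_single, ht])]
  obtain ⟨k, hk⟩ := Nat.even_or_odd' (M s t)
  rcases hk with hk | hk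
  · have e1 : (((M s t : ℕ) : ℤ) - 2) / 2 = k - 1 := by omega
    have e2 : (((M s t : ℕ) : ℤ) - 1) / 2 = k - 1 := by omega
    rw [e1, e2, hk, chebyshev_S_half_even (by omega)]
    simp
  · have e1 : (((M s t : ℕ) : ℤ) - 3) / 2 = k - 1 := by omega
    have e2 : (((M s t : ℕ) : ℤ) - 1) / 2 = k := by omega
    have e3 : (((M s t : ℕ) : ℤ)) / 2 = k := by omega
    have e4 : (((M s t : ℕ) : ℤ) - 2) / 2 = k - 1 := by omega
    rw [e1, e2, e3, e4, hk, chebyshev_S_half_odd (by omega)]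
    simp

open Polynomial.Chebyshev in
theorem geomReflection_mul_pow_eq_one {s t : B} (hst : s ≠ t) {k : ℕ} (hk : 0 < k)
    (h : (geomReflection M s * geomReflection M t) ^ k = 1) : M s t ≠ 0 ∧ M s t ∣ k := by
  have happ := congrArg (fun φ => φ (Finsupp.single s 1)) h
  simp only [LinearEquiv.coe_one, id_eq] at happ
  rw [geomReflection, geomReflection, Module.reflection_mul_reflection_pow_apply_self
    (coroot_single_self M s) (coroot_single_self M t) k _ rfl] at happ
  have hs := congrArg (fun φ => φ s) happ
  have ht := congrArg (fun φ => φ t) happ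
  simp only [Finsupp.add_apply, Finsupp.smul_apply, Finsupp.single_eq_same, smul_eq_mul,
    Finsupp.single_eq_of_ne hst, Finsupp.single_eq_of_ne hst.symm, mul_one, mul_zero, add_zero,
    zero_add, coroot_single] at hs ht
  by_cases h0 : M s t = 0
  · have h0' : M t s = 0 := by rw [M.symmetric, h0]
    simp only [cosEntry, h0, h0', if_true] at ht
    norm_num [S_eval_two] at ht
    omega
  refine ⟨h0, ?_⟩
  rw [cosEntry_mul_sub M h0] at hs ht
  have h1 : M s t ≠ 1 := M.off_diagonal s t hst
  by_cases h2 : M s t = 2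
  · rw [h2] at hs ⊢
    have : 2 * Real.cos (2 * Real.pi / (2 : ℕ)) = -2 := by norm_num
    rw [this, S_eval_neg_two, S_eval_neg_two] at hs
    by_contra hodd
    have ho : Odd k := by
      rw [← Nat.not_even_iff_odd, even_iff_two_dvd]; exact hodd
    rw [Int.negOnePow_odd _ (by exact_mod_cast ho), Int.negOnePow_even _ (by
      have : Odd (k : ℤ) := by exact_mod_cast ho
      exact this.sub_odd odd_one)] at hs
    push_cast at hs
    norm_num at hs
  have hm : 3 ≤ M s t := by omega
  have h3 := sin_two_pi_div_pos hm
  set θ := 2 * Real.pi / M s t with hθ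
  have hc : cosEntry M t s ≠ 0 := by
    rw [cosEntry_comm, cosEntry, if_neg h0]
    have : 0 < Real.cos (Real.pi / M s t) := by
      have hm' : (3 : ℝ) ≤ M s t := by exact_mod_cast hm
      apply Real.cos_pos_of_mem_Ioo
      constructor
      · have := Real.pi_pos
        have : 0 < Real.pi / M s t := by positivity
        linarith
      · apply div_lt_div_of_pos_left Real.pi_pos (by norm_num)
        linarith
    linarith
  have hz : (S ℝ (k - 1)).eval (2 * Real.cos θ) = 0 := by
    rcases mul_eq_zero.1 ht with h | h
    · exact h
    · exact absurd (neg_eq_zero.1 h) hc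
  rw [hz, add_zero] at hs
  have e1 := S_two_mul_real_cos (θ := θ) ((k : ℤ) - 1)
  have e2 := S_two_mul_real_cos (θ := θ) (k : ℤ)
  rw [hz, zero_mul] at e1
  rw [hs, one_mul] at e2
  push_cast at e1 e2
  rw [sub_add_cancel] at e1
  rw [add_mul, one_mul, Real.sin_add, ← e1, zero_mul, zero_add] at e2
  have e3 : Real.cos (k * θ) = 1 := by
    field_simp at e2
    exact e2.symm
  obtain ⟨n, hn⟩ := (Real.cos_eq_one_iff _).1 e3
  have hmpos : (M s t : ℝ) ≠ 0 := by positivity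
  have : (n : ℝ) * M s t = k := by
    rw [hθ] at hn
    field_simp at hn
    have := Real.pi_pos
    nlinarith
  have h4 : (n * (M s t : ℤ) : ℤ) = k := by exact_mod_cast this
  have : (M s t : ℤ) ∣ (k : ℤ) := ⟨n, by rw [← h4, mul_comm]⟩
  exact_mod_cast this

end Order

section CoxeterOrder

variable {W : Type*} [Group W] {M : CoxeterMatrix B} (cs : CoxeterSystem M W)

theorem dvd_of_simple_mul_simple_pow_eq_one {s t : B} (hst : s ≠ t) {k : ℕ} (hk : 0 < k)
    (h : (cs.simple s * cs.simple t) ^ k = 1) : M s t ≠ 0 ∧ M s t ∣ k := by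
  apply geomReflection_mul_pow_eq_one M hst hk
  have := congrArg (cs.lift ⟨geomReflection M, geomReflection_isLiftable M⟩) h
  simpa [cs.lift_apply_simple] using this

theorem simple_ne_simple {s t : B} (hst : s ≠ t) : cs.simple s ≠ cs.simple t := by
  intro h
  have := dvd_of_simple_mul_simple_pow_eq_one cs hst (k := 1) one_pos (by simp [h])
  exact M.off_diagonal s t hst (Nat.dvd_one.1 this.2)

end CoxeterOrder

section AltWords

variable {W : Type*} [Group W] {M : CoxeterMatrix B} (cs : CoxeterSystem M W)

theorem length_altList (s t : B) (k : ℕ) : (altList s t k).length = k := by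
  induction k generalizing s t with
  | zero => rfl
  | succ k ih => rw [altList, List.length_cons, ih]

theorem exists_pow_of_mem_leftInvSeq_altList {s t : B} {k : ℕ} {x : W}
    (hx : x ∈ cs.leftInvSeq (altList s t k)) :
    ∃ i < k, x = (cs.simple s * cs.simple t) ^ i * cs.simple s := by
  induction k generalizing s t x with
  | zero => simp [altList] at hx
  | succ k ih =>
    rw [altList, CoxeterSystem.leftInvSeq, List.mem_cons, List.mem_map] at hx
    rcases hx with rfl | ⟨y, hy, rfl⟩
    · exact ⟨0, Nat.succ_pos _, by simp⟩
    · obtain ⟨i, hi, rfl⟩ := ih hy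
      refine ⟨i + 1, Nat.succ_lt_succ hi, ?_⟩
      have h : SemiconjBy (cs.simple s) (cs.simple t * cs.simple s)
          (cs.simple s * cs.simple t) := by
        simp [SemiconjBy, mul_assoc]
      rw [MulAut.conj_apply, cs.inv_simple, ← mul_assoc, (h.pow_right i).eq, pow_succ]
      simp only [mul_assoc]

theorem isReduced_altList {s t : B} (hst : s ≠ t) {k : ℕ} (hk : M s t = 0 ∨ k ≤ M s t) :
    cs.IsReduced (altList s t k) := by
  induction k generalizing s t with
  | zero => simp [altList, CoxeterSystem.IsReduced]
  | succ k ih =>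
    have hsym := M.symmetric s t
    have hred := ih hst.symm (by omega)
    unfold CoxeterSystem.IsReduced at hred ⊢
    rw [length_altList] at hred ⊢
    rw [altList, cs.wordProd_cons]
    rcases cs.length_simple_mul (cs.wordProd (altList t s k)) s with h | h
    · rw [h, hred]
    · exfalso
      obtain ⟨i, hi, he⟩ := exists_pow_of_mem_leftInvSeq_altList cs
        (simple_mem_leftInvSeq cs (cs.isLeftDescent_iff.2 h))
      have h1 : (cs.simple t * cs.simple s) ^ (i + 1) = 1 := by
        rw [pow_succ, ← mul_assoc, ← he, cs.simple_mul_simple_self]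
      obtain ⟨h0, hd⟩ := dvd_of_simple_mul_simple_pow_eq_one cs hst.symm (Nat.succ_pos i) h1
      have := Nat.le_of_dvd (Nat.succ_pos i) hd
      omega

theorem length_wordProd_altList {s t : B} (hst : s ≠ t) {k : ℕ} (hk : M s t = 0 ∨ k ≤ M s t) :
    cs.length (cs.wordProd (altList s t k)) = k := by
  rw [isReduced_altList cs hst hk, length_altList]

theorem wordProd_altList_comm (s t : B) :
    cs.wordProd (altList s t (M s t)) = cs.wordProd (altList t s (M s t)) := by
  have hsym : M s t = M t s := M.symmetric s t
  have hb := cs.wordProd_braidWord_eq t s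
  rw [CoxeterSystem.braidWord, CoxeterSystem.braidWord, ← hsym] at hb
  rw [altList_eq_reverse_alternatingWord, altList_eq_reverse_alternatingWord,
    cs.wordProd_reverse, cs.wordProd_reverse, hb]

namespace WeakLE

variable {cs}

theorem altList_of_simple {s t : B} (hst : s ≠ t) {w : W} (hs : WeakLE cs (cs.simple s) w)
    (ht : WeakLE cs (cs.simple t) w) {k : ℕ} (hk : M s t = 0 ∨ k ≤ M s t) :
    WeakLE cs (cs.wordProd (altList s t k)) w := by
  induction k generalizing s t with
  | zero => exact WeakLE.one_le cs w
  | succ k ih =>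
    have hsym := M.symmetric s t
    have h := ih hst.symm ht hs (by omega)
    have hl := length_wordProd_altList cs hst hk
    rw [altList, cs.wordProd_cons] at hl ⊢
    apply simple_mul hs h
    rw [hl, length_wordProd_altList cs hst.symm (by omega)]
    exact Nat.lt_succ_self k

theorem braid_of_simple {s t : B} (hst : s ≠ t) {w : W} (hs : WeakLE cs (cs.simple s) w)
    (ht : WeakLE cs (cs.simple t) w) :
    M s t ≠ 0 ∧ WeakLE cs (cs.wordProd (altList s t (M s t))) w := by
  have h0 : M s t ≠ 0 := by
    intro h0
    have h1 := (altList_of_simple hst hs ht (k := cs.length w + 1) (Or.inl h0)).length_le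
    rw [length_wordProd_altList cs hst (Or.inl h0)] at h1
    omega
  exact ⟨h0, altList_of_simple hst hs ht (Or.inr le_rfl)⟩

end WeakLE

end AltWords

section GenericLcm

/-- If pairs of atoms below a bound have least common multiples, then so do all pairs of
elements below a bound. -/
theorem exists_lcm_of_local {H : Type*} [Group H] (le : H → H → Prop) (Q : H → Prop)
    (S : Set H) (ℓ : H → ℕ)
    (hrefl : ∀ x, Q x → le x x) (hone : ∀ x, Q x → le 1 x)
    (htrans : ∀ x y z, le x y → le y z → le x z)
    (hdiv : ∀ u x y, le u x → le x y → le (u⁻¹ * x) (u⁻¹ * y))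
    (hmul : ∀ u v a, le u a → le v (u⁻¹ * a) → le u (u * v) ∧ le (u * v) a)
    (hQ1 : Q 1) (hQmul : ∀ x y, Q x → Q y → Q (x * y))
    (hatom : ∀ d, Q d → d = 1 ∨ ∃ s ∈ S, le s d ∧ Q (s⁻¹ * d))
    (hlen : ∀ u a, le u a → ℓ (u⁻¹ * a) ≤ ℓ a)
    (hlenS : ∀ s ∈ S, ∀ a, le s a → ℓ (s⁻¹ * a) < ℓ a)
    (hloc : ∀ s ∈ S, ∀ t ∈ S, ∀ a, le s a → le t a → ∃ l, Q (s⁻¹ * l) ∧ Q (t⁻¹ * l) ∧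
      le s l ∧ le t l ∧ ∀ c, le s c → le t c → le l c)
    {d e a : H} (hd : Q d) (he : Q e) (hda : le d a) (hea : le e a) :
    ∃ l, Q (d⁻¹ * l) ∧ Q (e⁻¹ * l) ∧ le d l ∧ le e l ∧ ∀ c, le d c → le e c → le l c := by
  induction hn : ℓ a using Nat.strong_induction_on generalizing d e a with
  | _ n ih =>
  subst hn
  rcases hatom d hd with rfl | ⟨s, hs, hsd, hQd⟩
  · exact ⟨e, by simpa using he, by simpa using hQ1, hone e he, hrefl e he, fun c _ h => h⟩
  rcases hatom e he with rfl | ⟨t, ht, hte, hQe⟩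
  · exact ⟨d, by simpa using hQ1, by simpa using hd, hrefl d hd, hone d hd, fun c h _ => h⟩
  have hsa := htrans _ _ _ hsd hda
  have hta := htrans _ _ _ hte hea
  obtain ⟨L, hQs, hQt, hsL, htL, hL⟩ := hloc s hs t ht a hsa hta
  have hLa := hL a hsa hta
  -- common multiples one level down
  obtain ⟨d₂, hd₂, hp₂, hdd₂, hpd₂, hm₂⟩ := ih _ (hlenS s hs a hsa) hQd hQs
    (hdiv _ _ _ hsd hda) (hdiv _ _ _ hsL hLa) rfl
  obtain ⟨e₂, he₂, hq₂, hee₂, hqe₂, hm₂'⟩ := ih _ (hlenS t ht a hta) hQe hQt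
    (hdiv _ _ _ hte hea) (hdiv _ _ _ htL hLa) rfl
  have hd₂a := hm₂ _ (hdiv _ _ _ hsd hda) (hdiv _ _ _ hsL hLa)
  have he₂a := hm₂' _ (hdiv _ _ _ hte hea) (hdiv _ _ _ htL hLa)
  have hx := hdiv _ _ _ hpd₂ hd₂a
  have hy := hdiv _ _ _ hqe₂ he₂a
  have eqs : ∀ z, (s⁻¹ * L)⁻¹ * (s⁻¹ * z) = L⁻¹ * z := by intro z; group
  have eqt : ∀ z, (t⁻¹ * L)⁻¹ * (t⁻¹ * z) = L⁻¹ * z := by intro z; group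
  rw [eqs] at hx
  rw [eqt] at hy
  have hlt : ℓ (L⁻¹ * a) < ℓ a := by
    have h1 := hlen _ _ (hdiv _ _ _ hsL hLa)
    rw [eqs] at h1
    exact lt_of_le_of_lt h1 (hlenS s hs a hsa)
  obtain ⟨m, hm1, hm2, hxm, hym, hm⟩ := ih _ hlt hp₂ hq₂ hx hy rfl
  have hma := hm _ hx hy
  -- `s * d₂` and `t * e₂` divide `L * m`
  have hsd₂ : ∀ c, le d c → le L c → le (s * d₂) c := by
    intro c h1 h2
    have hsc := htrans _ _ _ hsd h1
    exact (hmul s d₂ c hsc (hm₂ _ (hdiv _ _ _ hsd h1) (hdiv _ _ _ hsL h2))).2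
  have hte₂ : ∀ c, le e c → le L c → le (t * e₂) c := by
    intro c h1 h2
    have htc := htrans _ _ _ hte h1
    exact (hmul t e₂ c htc (hm₂' _ (hdiv _ _ _ hte h1) (hdiv _ _ _ htL h2))).2
  have hLm := hmul L m a hLa hma
  have h3 : le (s * d₂) (L * m) := by
    have h := (hmul L ((s⁻¹ * L)⁻¹ * d₂) (L * m) hLm.1 (by simpa using hxm)).2
    have e : L * ((s⁻¹ * L)⁻¹ * d₂) = s * d₂ := by group
    rwa [e] at h
  have h4 : le (t * e₂) (L * m) := by
    have h := (hmul L ((t⁻¹ * L)⁻¹ * e₂) (L * m) hLm.1 (by simpa using hym)).2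
    have e : L * ((t⁻¹ * L)⁻¹ * e₂) = t * e₂ := by group
    rwa [e] at h
  have hdd : le d (s * d₂) := by
    have h1 := hmul s d₂ a hsa hd₂a
    have h := (hmul s (s⁻¹ * d) (s * d₂) h1.1 (by simpa using hdd₂)).2
    simpa using h
  have hee : le e (t * e₂) := by
    have h1 := hmul t e₂ a hta he₂a
    have h := (hmul t (t⁻¹ * e) (t * e₂) h1.1 (by simpa using hee₂)).2
    simpa using h
  refine ⟨L * m, ?_, ?_, htrans _ _ _ hdd h3, htrans _ _ _ hee h4, ?_⟩
  · have h := hQmul _ _ hd₂ hm1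
    have e : (s⁻¹ * d)⁻¹ * d₂ * (((s⁻¹ * L)⁻¹ * d₂)⁻¹ * m) = d⁻¹ * (L * m) := by group
    rwa [e] at h
  · have h := hQmul _ _ he₂ hm2
    have e : (t⁻¹ * e)⁻¹ * e₂ * (((t⁻¹ * L)⁻¹ * e₂)⁻¹ * m) = e⁻¹ * (L * m) := by group
    rwa [e] at h
  · intro c hdc hec
    have hLc := hL c (htrans _ _ _ hsd hdc) (htrans _ _ _ hte hec)
    have h5 := hsd₂ c hdc hLc
    have h6 := hte₂ c hec hLc
    have hLsd : le L (s * d₂) := by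
      have h1 := hmul s d₂ a hsa hd₂a
      have h := (hmul s (s⁻¹ * L) (s * d₂) h1.1 (by simpa using hpd₂)).2
      simpa using h
    have hLte : le L (t * e₂) := by
      have h1 := hmul t e₂ a hta he₂a
      have h := (hmul t (t⁻¹ * L) (t * e₂) h1.1 (by simpa using hqe₂)).2
      simpa using h
    have h7 := hdiv _ _ _ hLsd h5
    have h8 := hdiv _ _ _ hLte h6
    have e1 : L⁻¹ * (s * d₂) = (s⁻¹ * L)⁻¹ * d₂ := by group
    have e2 : L⁻¹ * (t * e₂) = (t⁻¹ * L)⁻¹ * e₂ := by group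
    rw [e1] at h7
    rw [e2] at h8
    exact (hmul L m c hLc (hm _ h7 h8)).2

end GenericLcm

section Longest

variable {W : Type*} [Group W] {M : CoxeterMatrix B} (cs : CoxeterSystem M W)

theorem exists_weakLE_atom (w : W) :
    w = 1 ∨ ∃ s, WeakLE cs (cs.simple s) w ∧
      cs.length ((cs.simple s)⁻¹ * w) < cs.length w := by
  by_cases h : w = 1
  · exact Or.inl h
  · obtain ⟨s, hs⟩ := cs.exists_leftDescent_of_ne_one h
    refine Or.inr ⟨s, WeakLE.simple_iff.2 hs, ?_⟩
    rw [cs.inv_simple]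
    exact hs

theorem exists_forall_weakLE [Finite W] : ∃ w₀ : W, ∀ w, WeakLE cs w w₀ := by
  obtain ⟨w₀, hw₀⟩ := Finite.exists_max cs.length
  refine ⟨w₀, fun w => ?_⟩
  have hs : ∀ s, WeakLE cs (cs.simple s) w₀ := by
    intro s
    rw [WeakLE.simple_iff, cs.isLeftDescent_iff]
    have := cs.length_simple_mul w₀ s
    have := hw₀ (cs.simple s * w₀)
    omega
  induction hn : cs.length w using Nat.strong_induction_on generalizing w with
  | _ n ih =>
  subst hn
  rcases exists_weakLE_atom cs w with rfl | ⟨s, -, hlt⟩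
  · exact WeakLE.one_le cs w₀
  · have h := (hs s).simple_mul (ih _ hlt _ rfl)
    rw [cs.inv_simple, cs.simple_mul_simple_cancel_left] at h
    exact h (by rwa [cs.inv_simple] at hlt)

theorem exists_isGLB_weakLE [Finite W] (x y : W) :
    ∃ m, WeakLE cs m x ∧ WeakLE cs m y ∧
      ∀ z, WeakLE cs z x → WeakLE cs z y → WeakLE cs z m := by
  have : Nonempty {z : W // WeakLE cs z x ∧ WeakLE cs z y} :=
    ⟨⟨1, WeakLE.one_le cs x, WeakLE.one_le cs y⟩⟩
  obtain ⟨⟨m, hmx, hmy⟩, hm⟩ := Finite.exists_max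
    (fun z : {z : W // WeakLE cs z x ∧ WeakLE cs z y} => cs.length z.1)
  refine ⟨m, hmx, hmy, fun z hzx hzy => ?_⟩
  obtain ⟨l, -, -, hml, hzl, hl⟩ := exists_lcm_of_local (WeakLE cs) (fun _ => True)
    (Set.range cs.simple) cs.length (fun x _ => WeakLE.refl cs x) (fun x _ => WeakLE.one_le cs x)
    (fun _ _ _ h h' => h.trans h') (fun _ _ _ h h' => h.inv_mul h')
    (fun _ _ _ h h' => h.mul_left_le h') trivial (fun _ _ _ _ => trivial)
    (fun d _ => (exists_weakLE_atom cs d).imp_right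
      fun ⟨s, hs, _⟩ => ⟨_, ⟨s, rfl⟩, hs, trivial⟩)
    (fun u a h => by unfold WeakLE at h; omega)
    (by
      rintro _ ⟨s, rfl⟩ a h
      rw [cs.inv_simple]
      exact WeakLE.simple_iff.1 h)
    (by
      rintro _ ⟨s, rfl⟩ _ ⟨t, rfl⟩ a hs ht
      by_cases hst : s = t
      · subst hst
        exact ⟨_, trivial, trivial, WeakLE.refl cs _, WeakLE.refl cs _, fun c h _ => h⟩
      · have h0 := (WeakLE.braid_of_simple hst hs ht).1
        have key : ∀ s t, s ≠ t → M s t ≠ 0 →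
            WeakLE cs (cs.simple s) (cs.wordProd (altList s t (M s t))) := by
          intro s t hst h0
          obtain ⟨k, hk⟩ := Nat.exists_eq_succ_of_ne_zero h0
          rw [WeakLE.simple_iff, CoxeterSystem.IsLeftDescent,
            length_wordProd_altList cs hst (Or.inr le_rfl), hk, altList, cs.wordProd_cons,
            cs.simple_mul_simple_cancel_left]
          have := cs.length_wordProd_le (altList t s k)
          rw [length_altList] at this
          omega
        refine ⟨cs.wordProd (altList s t (M s t)), trivial, trivial, key s t hst h0, ?_,
          fun c h h' => (WeakLE.braid_of_simple hst h h').2⟩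
        rw [wordProd_altList_comm, M.symmetric s t]
        exact key t s (Ne.symm hst) (by rwa [M.symmetric t s]))
    (d := m) (e := z) (a := x) trivial trivial hmx hzx
  have h := hm ⟨l, hl x hmx hzx, hl y hmy hzy⟩
  rw [hml.eq_of_length_le h]
  exact hzl

variable [Finite W]

/-- The longest element of a finite Coxeter group. -/
noncomputable def longest : W := (exists_forall_weakLE cs).choose

theorem weakLE_longest (w : W) : WeakLE cs w (longest cs) :=
  (exists_forall_weakLE cs).choose_spec w

theorem longest_inv : (longest cs)⁻¹ = longest cs :=
  (weakLE_longest cs _).eq_of_length_le (by rw [cs.length_inv])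

theorem longest_mul_self : longest cs * longest cs = 1 := by
  nth_rw 1 [← longest_inv cs]
  exact inv_mul_cancel _

theorem exists_simple_eq_conj_longest (s : B) :
    ∃ s', cs.simple s' = longest cs * cs.simple s * longest cs := by
  have h1 := weakLE_longest cs (cs.simple s)
  have h2 := weakLE_longest cs ((cs.simple s)⁻¹ * longest cs)
  unfold WeakLE at h1 h2
  rw [cs.length_simple] at h1
  have : cs.length (((cs.simple s)⁻¹ * longest cs)⁻¹ * longest cs) = 1 := by omega
  rw [cs.length_eq_one_iff] at this
  obtain ⟨s', hs'⟩ := this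
  refine ⟨s', ?_⟩
  rw [← hs', mul_inv_rev, inv_inv, longest_inv]

theorem weakLE_inv_mul_longest {w v : W} :
    WeakLE cs v (w⁻¹ * longest cs) ↔ cs.length (w * v) = cs.length w + cs.length v := by
  rw [← WeakLE.mul_right_iff]
  constructor
  · intro h
    exact ((weakLE_longest cs w).mul_left_le h).1
  · intro h
    simpa using h.inv_mul (weakLE_longest cs (w * v))

/-- The meet of two elements for the weak order. -/
noncomputable def weakMeet (x y : W) : W := (exists_isGLB_weakLE cs x y).choose

theorem weakMeet_le_left (x y : W) : WeakLE cs (weakMeet cs x y) x :=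
  (exists_isGLB_weakLE cs x y).choose_spec.1

theorem weakMeet_le_right (x y : W) : WeakLE cs (weakMeet cs x y) y :=
  (exists_isGLB_weakLE cs x y).choose_spec.2.1

theorem le_weakMeet {x y z : W} (h : WeakLE cs z x) (h' : WeakLE cs z y) :
    WeakLE cs z (weakMeet cs x y) :=
  (exists_isGLB_weakLE cs x y).choose_spec.2.2 z h h'

end Longest

section Monoid

variable (M : CoxeterMatrix B)

/-- The defining relations of the Artin-Tits monoid. -/
inductive BraidMonRel : FreeMonoid B → FreeMonoid B → Prop
  | braid (s t : B) (hst : s ≠ t) (h0 : M s t ≠ 0) :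
      BraidMonRel (FreeMonoid.ofList (altList s t (M s t)))
        (FreeMonoid.ofList (altList t s (M s t)))

/-- The Artin-Tits monoid, presented by the braid relations. -/
abbrev ArtinMon : Type _ := PresentedMonoid (BraidMonRel M)

/-- The element of the Artin-Tits monoid represented by a word. -/
def monWord (ω : List B) : ArtinMon M :=
  PresentedMonoid.mk (BraidMonRel M) (FreeMonoid.ofList ω)

/-- The generators of the Artin-Tits monoid. -/
def monGen (s : B) : ArtinMon M := PresentedMonoid.of (BraidMonRel M) s

theorem monWord_nil : monWord M [] = 1 := rfl

theorem monWord_cons (s : B) (ω : List B) : monWord M (s :: ω) = monGen M s * monWord M ω := rfl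

theorem monWord_append (ω ω' : List B) :
    monWord M (ω ++ ω') = monWord M ω * monWord M ω' := rfl

theorem monWord_altList {s t : B} (hst : s ≠ t) (h0 : M s t ≠ 0) :
    monWord M (altList s t (M s t)) = monWord M (altList t s (M s t)) :=
  PresentedMonoid.mk_eq_mk_of_rel (BraidMonRel.braid s t hst h0)

theorem exists_monWord (a : ArtinMon M) : ∃ ω, monWord M ω = a := by
  induction a using PresentedMonoid.inductionOn with
  | _ w => exact ⟨w.toList, rfl⟩

theorem artinMon_induction {p : ArtinMon M → Prop} (h1 : p 1)
    (hmul : ∀ s a, p a → p (monGen M s * a)) (a : ArtinMon M) : p a := by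
  obtain ⟨ω, rfl⟩ := exists_monWord M a
  induction ω with
  | nil => exact h1
  | cons s ω ih => exact hmul s _ ih

variable {M} {W : Type*} [Group W] (cs : CoxeterSystem M W)

/-- Matsumoto's theorem: reduced words of the same element are equal in the Artin-Tits monoid. -/
theorem monWord_eq_of_isReduced {ω ω' : List B} (h : cs.IsReduced ω) (h' : cs.IsReduced ω')
    (he : cs.wordProd ω = cs.wordProd ω') : monWord M ω = monWord M ω' := by
  have hlen : ω.length = ω'.length := by rw [← h, ← h', he]
  induction hn : ω.length using Nat.strong_induction_on generalizing ω ω' with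
  | _ n ih =>
  subst hn
  match ω, ω', hlen with
  | [], [], _ => rfl
  | s :: ω₁, t :: ω₁', hlen =>
    have ihc : ∀ (s : B) (η η' : List B), η.length ≤ ω₁.length → cs.IsReduced (s :: η) →
        cs.IsReduced (s :: η') → cs.wordProd (s :: η) = cs.wordProd (s :: η') →
        monWord M (s :: η) = monWord M (s :: η') := by
      intro s η η' hl hr hr' he
      have e := he
      rw [cs.wordProd_cons, cs.wordProd_cons, mul_right_inj] at e
      have hle : η.length = η'.length := by
        have := hr.symm.trans ((congrArg cs.length he).trans hr')
        simpa using this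
      rw [monWord_cons, monWord_cons, ih η.length (by simpa using Nat.lt_succ_of_le hl)
        (by simpa using hr.drop 1) (by simpa using hr'.drop 1) e hle rfl]
    have desc : ∀ (s : B) (η : List B), cs.IsReduced (s :: η) →
        WeakLE cs (cs.simple s) (cs.wordProd (s :: η)) := by
      intro s η hr
      rw [WeakLE.simple_iff, CoxeterSystem.IsLeftDescent, hr, cs.wordProd_cons,
        cs.simple_mul_simple_cancel_left]
      exact Nat.lt_succ_of_le (cs.length_wordProd_le η)
    by_cases hst : s = t
    · subst hst
      exact ihc s ω₁ ω₁' le_rfl h h' he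
    have hs := desc s ω₁ h
    have ht := desc t ω₁' h'
    rw [← he] at ht
    obtain ⟨h0, hle⟩ := WeakLE.braid_of_simple hst hs ht
    obtain ⟨k, hk⟩ := Nat.exists_eq_succ_of_ne_zero h0
    obtain ⟨υ, hυ, hυ'⟩ := cs.exists_isReduced
      ((cs.wordProd (altList s t (M s t)))⁻¹ * cs.wordProd (s :: ω₁))
    have e1 : cs.wordProd (s :: ω₁) = cs.wordProd (altList s t (M s t) ++ υ) := by
      rw [cs.wordProd_append, ← hυ', mul_inv_cancel_left]
    have e2 : cs.wordProd (s :: ω₁) = cs.wordProd (altList t s (M s t) ++ υ) := by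
      rw [e1, cs.wordProd_append, cs.wordProd_append, wordProd_altList_comm]
    unfold WeakLE at hle
    rw [length_wordProd_altList cs hst (Or.inr le_rfl), hυ', hυ, h, List.length_cons] at hle
    have r1 : cs.IsReduced (altList s t (M s t) ++ υ) := by
      rw [CoxeterSystem.IsReduced, ← e1, h, List.length_append, length_altList,
        List.length_cons, hle]
    have r2 : cs.IsReduced (altList t s (M s t) ++ υ) := by
      rw [CoxeterSystem.IsReduced, ← e2, h, List.length_append, length_altList,
        List.length_cons, hle]
    have hb : monWord M (altList s t (M s t) ++ υ) = monWord M (altList t s (M s t) ++ υ) := by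
      rw [monWord_append, monWord_append, monWord_altList M hst h0]
    rw [hk, altList, altList, List.cons_append, List.cons_append] at *
    rw [ihc s _ _ le_rfl h r1 e1, hb]
    refine (ihc t _ _ ?_ h' r2 (he.symm.trans e2)).symm
    simp only [List.length_cons] at hlen
    omega

/-- The canonical section from a Coxeter group to the Artin-Tits monoid. -/
noncomputable def redLift (w : W) : ArtinMon M := monWord M (cs.exists_isReduced w).choose

theorem redLift_wordProd {ω : List B} (h : cs.IsReduced ω) :
    redLift cs (cs.wordProd ω) = monWord M ω := by
  have := (cs.exists_isReduced (cs.wordProd ω)).choose_spec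
  exact monWord_eq_of_isReduced cs this.1 h this.2.symm

theorem redLift_one : redLift cs 1 = 1 := by
  rw [← cs.wordProd_nil, redLift_wordProd cs (by simp [CoxeterSystem.IsReduced]), monWord_nil]

theorem redLift_simple (s : B) : redLift cs (cs.simple s) = monGen M s := by
  rw [← cs.wordProd_singleton, redLift_wordProd cs (by simp [CoxeterSystem.IsReduced])]
  rfl

theorem redLift_mul {w v : W} (h : cs.length (w * v) = cs.length w + cs.length v) :
    redLift cs (w * v) = redLift cs w * redLift cs v := by
  obtain ⟨ω, hω, rfl⟩ := cs.exists_isReduced w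
  obtain ⟨υ, hυ, rfl⟩ := cs.exists_isReduced v
  rw [← cs.wordProd_append] at h ⊢
  have : cs.IsReduced (ω ++ υ) := by
    rw [CoxeterSystem.IsReduced, h, hω, hυ, List.length_append]
  rw [redLift_wordProd cs this, redLift_wordProd cs hω, redLift_wordProd cs hυ, monWord_append]

theorem redLift_mul_of_weakLE {v w : W} (h : WeakLE cs v w) :
    redLift cs v * redLift cs (v⁻¹ * w) = redLift cs w := by
  rw [← redLift_mul, mul_inv_cancel_left]
  rw [mul_inv_cancel_left]
  exact h.symm

end Monoid

section NormalForm

variable {M : CoxeterMatrix B} {W : Type*} [Group W] [Finite W] (cs : CoxeterSystem M W)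

/-- Left multiplication by `w` on left-greedy pairs. -/
noncomputable def greedyStep (w : W) : Function.End (W × ArtinMon M) := fun p =>
  (w * weakMeet cs p.1 (w⁻¹ * longest cs),
    redLift cs ((weakMeet cs p.1 (w⁻¹ * longest cs))⁻¹ * p.1) * p.2)

theorem greedyStep_one : greedyStep cs 1 = 1 := by
  funext ⟨x, h⟩
  have : weakMeet cs x (longest cs) = x :=
    (weakMeet_le_left cs x _).antisymm (le_weakMeet cs (WeakLE.refl cs x) (weakLE_longest cs x))
  simp only [greedyStep, one_mul, inv_one, this, inv_mul_cancel, redLift_one]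
  rfl

theorem greedyStep_mul {w w' : W} (hl : cs.length (w * w') = cs.length w + cs.length w') :
    greedyStep cs (w * w') = greedyStep cs w * greedyStep cs w' := by
  funext ⟨x, h⟩
  change _ = greedyStep cs w (greedyStep cs w' (x, h))
  simp only [greedyStep]
  set v₁ := weakMeet cs x (w'⁻¹ * longest cs) with hv₁
  set v₂ := weakMeet cs (w' * v₁) (w⁻¹ * longest cs) with hv₂
  set v₃ := weakMeet cs x ((w * w')⁻¹ * longest cs) with hv₃
  have a₁ := weakLE_inv_mul_longest cs |>.1 (weakMeet_le_right cs x (w'⁻¹ * longest cs))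
  have a₂ := weakLE_inv_mul_longest cs |>.1 (weakMeet_le_right cs (w' * v₁) (w⁻¹ * longest cs))
  have a₃ := weakLE_inv_mul_longest cs |>.1 (weakMeet_le_right cs x ((w * w')⁻¹ * longest cs))
  rw [← hv₁] at a₁
  rw [← hv₂] at a₂
  rw [← hv₃] at a₃
  have b₃ : cs.length (w' * v₃) = cs.length w' + cs.length v₃ := by
    have h1 := cs.length_mul_le w (w' * v₃)
    have h2 := cs.length_mul_le w' v₃
    rw [← mul_assoc] at h1
    omega
  have h31 : WeakLE cs v₃ v₁ :=
    le_weakMeet cs (weakMeet_le_left cs _ _) ((weakLE_inv_mul_longest cs).2 b₃)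
  have hw'1 : WeakLE cs w' (w' * v₁) := WeakLE.mul_right_iff.2 a₁
  have hle : WeakLE cs (w' * v₃) v₂ := by
    apply le_weakMeet
    · exact (hw'1.mul_left_le (by simpa using h31)).2
    · rw [weakLE_inv_mul_longest, ← mul_assoc]
      omega
  have hw'2 : WeakLE cs w' v₂ :=
    le_weakMeet cs hw'1 ((weakLE_inv_mul_longest cs).2 hl)
  have hge : WeakLE cs (w'⁻¹ * v₂) v₃ := by
    apply le_weakMeet
    · have h1 := hw'2.inv_mul (weakMeet_le_left cs _ _)
      rw [inv_mul_cancel_left] at h1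
      exact h1.trans (weakMeet_le_left cs _ _)
    · rw [weakLE_inv_mul_longest]
      have e : w * w' * (w'⁻¹ * v₂) = w * v₂ := by group
      rw [e, a₂, hl, ← hw'2]
      ring
  have e₂ : v₂ = w' * v₃ := by
    refine WeakLE.antisymm ?_ hle
    have := ((WeakLE.mul_right_iff.2 b₃ : WeakLE cs w' _).mul_left_le
      (by simpa using hge)).2
    simpa using this
  have e₃ : v₂⁻¹ * (w' * v₁) = v₃⁻¹ * v₁ := by rw [e₂]; group
  refine Prod.ext ?_ ?_
  · simp only [e₂, mul_assoc]
  · simp only [e₃]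
    have h1 := h31.inv_mul (weakMeet_le_left cs x (w'⁻¹ * longest cs))
    have h2 := redLift_mul_of_weakLE cs h1
    rw [← h2, mul_assoc, show (v₃⁻¹ * v₁)⁻¹ * (v₃⁻¹ * x) = v₁⁻¹ * x by group]

theorem greedyStep_wordProd {ω : List B} (hω : cs.IsReduced ω) :
    greedyStep cs (cs.wordProd ω) =
      (ω.map fun s => greedyStep cs (cs.simple s)).prod := by
  induction ω with
  | nil => simpa using greedyStep_one cs
  | cons s ω ih =>
    have hr : cs.IsReduced ω := by simpa using hω.drop 1
    rw [List.map_cons, List.prod_cons, ← ih hr, cs.wordProd_cons, greedyStep_mul]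
    rw [← cs.wordProd_cons, hω, hr, cs.length_simple, List.length_cons, add_comm]

/-- The action of the Artin-Tits monoid on left-greedy pairs. -/
noncomputable def greedyAction : ArtinMon M →* Function.End (W × ArtinMon M) :=
  PresentedMonoid.lift (fun s => greedyStep cs (cs.simple s)) (by
    rintro _ _ ⟨s, t, hst, h0⟩
    rw [FreeMonoid.lift_ofList, FreeMonoid.lift_ofList,
      ← greedyStep_wordProd cs (isReduced_altList cs hst (Or.inr le_rfl)),
      ← greedyStep_wordProd cs (isReduced_altList cs (Ne.symm hst)
        (Or.inr (M.symmetric s t).le)), wordProd_altList_comm])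

theorem greedyAction_gen (s : B) :
    greedyAction cs (monGen M s) = greedyStep cs (cs.simple s) :=
  rfl

theorem redLift_greedyStep (w : W) (p : W × ArtinMon M) :
    redLift cs (greedyStep cs w p).1 * (greedyStep cs w p).2 =
      redLift cs w * (redLift cs p.1 * p.2) := by
  simp only [greedyStep]
  rw [redLift_mul cs ((weakLE_inv_mul_longest cs).1 (weakMeet_le_right cs _ _)), mul_assoc,
    ← mul_assoc (redLift cs (weakMeet cs p.1 _)), redLift_mul_of_weakLE cs (weakMeet_le_left cs _ _)]

theorem redLift_greedyAction (a : ArtinMon M) :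
    redLift cs (greedyAction cs a (1, 1)).1 * (greedyAction cs a (1, 1)).2 = a := by
  induction a using artinMon_induction with
  | h1 => rw [map_one]; exact (mul_one _).trans (redLift_one cs)
  | hmul s a ih =>
    rw [map_mul, greedyAction_gen]
    change redLift cs (greedyStep cs (cs.simple s) (greedyAction cs a (1, 1))).1 *
      (greedyStep cs (cs.simple s) (greedyAction cs a (1, 1))).2 = _
    rw [redLift_greedyStep, ih, redLift_simple]

include cs in
theorem monGen_mul_left_cancel {s : B} {a b : ArtinMon M}
    (h : monGen M s * a = monGen M s * b) : a = b := by
  have h1 := congrArg (fun g => greedyAction cs g (1, 1)) h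
  simp only [map_mul, greedyAction_gen] at h1
  change greedyStep cs (cs.simple s) (greedyAction cs a (1, 1)) =
    greedyStep cs (cs.simple s) (greedyAction cs b (1, 1)) at h1
  rw [← redLift_greedyAction cs a, ← redLift_greedyAction cs b]
  generalize greedyAction cs a (1, 1) = p at *
  generalize greedyAction cs b (1, 1) = q at *
  have e1 := congrArg Prod.fst h1
  have e2 := congrArg Prod.snd h1
  simp only [greedyStep, mul_right_inj] at e1 e2
  rw [← redLift_mul_of_weakLE cs (weakMeet_le_left cs p.1 ((cs.simple s)⁻¹ * longest cs)),
    mul_assoc, e2, e1, ← mul_assoc, redLift_mul_of_weakLE cs (weakMeet_le_left cs _ _)]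

theorem simple_weakLE_greedyAction (s : B) (a : ArtinMon M) :
    WeakLE cs (cs.simple s) (greedyAction cs (monGen M s * a) (1, 1)).1 := by
  rw [map_mul, greedyAction_gen]
  change WeakLE cs (cs.simple s)
    (greedyStep cs (cs.simple s) (greedyAction cs a (1, 1))).1
  rw [greedyStep, WeakLE.mul_right_iff]
  exact (weakLE_inv_mul_longest cs).1 (weakMeet_le_right cs _ _)

include cs in
theorem exists_monWord_altList_mul {s t : B} (hst : s ≠ t) {a b : ArtinMon M}
    (h : monGen M s * a = monGen M t * b) :
    M s t ≠ 0 ∧ ∃ c, monGen M s * a = monWord M (altList s t (M s t)) * c := by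
  have hs := simple_weakLE_greedyAction cs s a
  have ht := simple_weakLE_greedyAction cs t b
  rw [← h] at ht
  obtain ⟨h0, hle⟩ := WeakLE.braid_of_simple hst hs ht
  refine ⟨h0, ?_⟩
  rw [← redLift_greedyAction cs (monGen M s * a), ← redLift_mul_of_weakLE cs hle, mul_assoc,
    redLift_wordProd cs (isReduced_altList cs hst (Or.inr le_rfl))]
  exact ⟨_, rfl⟩

end NormalForm

section Garside

variable {M : CoxeterMatrix B} {W : Type*} [Group W] [Finite W] (cs : CoxeterSystem M W)

include cs in
theorem artinMon_mul_left_cancel {c a b : ArtinMon M} (h : c * a = c * b) : a = b := by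
  induction c using artinMon_induction with
  | h1 => simpa using h
  | hmul s c ih =>
    rw [mul_assoc, mul_assoc] at h
    exact ih (monGen_mul_left_cancel cs h)

theorem redLift_longest_eq (s : B) :
    monGen M s * redLift cs (cs.simple s * longest cs) = redLift cs (longest cs) := by
  have := redLift_mul_of_weakLE cs (weakLE_longest cs (cs.simple s))
  rwa [redLift_simple, cs.inv_simple] at this

/-- The permutation of the generators induced by conjugation by the longest element. -/
noncomputable def conjLongest (s : B) : B := (exists_simple_eq_conj_longest cs s).choose

theorem simple_conjLongest (s : B) :
    cs.simple (conjLongest cs s) = longest cs * cs.simple s * longest cs :=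
  (exists_simple_eq_conj_longest cs s).choose_spec

theorem conjLongest_conjLongest (s : B) : conjLongest cs (conjLongest cs s) = s := by
  by_contra h
  apply simple_ne_simple cs h
  rw [simple_conjLongest, simple_conjLongest]
  have := longest_mul_self cs
  rw [mul_assoc, mul_assoc, mul_assoc, this, mul_one, ← mul_assoc, this, one_mul]

theorem monGen_mul_redLift_longest (s : B) :
    monGen M s * redLift cs (longest cs) =
      redLift cs (longest cs) * monGen M (conjLongest cs s) := by
  have h := weakLE_longest cs (cs.simple s * longest cs)
  have h2 := redLift_mul_of_weakLE cs h
  have e : (cs.simple s * longest cs)⁻¹ * longest cs = cs.simple (conjLongest cs s) := by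
    rw [simple_conjLongest, mul_inv_rev, longest_inv, cs.inv_simple]
  rw [e, redLift_simple] at h2
  conv_rhs => rw [← redLift_longest_eq cs s]
  rw [mul_assoc, h2]

theorem commute_redLift_longest_sq (a : ArtinMon M) :
    Commute a (redLift cs (longest cs) * redLift cs (longest cs)) := by
  induction a using artinMon_induction with
  | h1 => exact Commute.one_left _
  | hmul s a ih =>
    refine Commute.mul_left ?_ ih
    rw [Commute, SemiconjBy, ← mul_assoc, monGen_mul_redLift_longest, mul_assoc,
      monGen_mul_redLift_longest, conjLongest_conjLongest, mul_assoc]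

theorem exists_mul_eq_redLift_longest_pow (a : ArtinMon M) :
    ∃ (n : ℕ) (c : ArtinMon M),
      a * c = (redLift cs (longest cs) * redLift cs (longest cs)) ^ n := by
  induction a using artinMon_induction with
  | h1 => exact ⟨0, 1, by simp⟩
  | hmul s a ih =>
    obtain ⟨n, c, hc⟩ := ih
    refine ⟨n + 1, c * (redLift cs (cs.simple s * longest cs) * redLift cs (longest cs)), ?_⟩
    have hcomm := (commute_redLift_longest_sq cs (monGen M s)).pow_right n
    rw [mul_assoc, ← mul_assoc a, hc, ← mul_assoc, hcomm.eq, mul_assoc, ← mul_assoc (monGen M s),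
      redLift_longest_eq, pow_succ]

theorem exists_mul_eq_redLift_longest_pow' (a : ArtinMon M) :
    ∃ (n : ℕ) (c : ArtinMon M),
      a * c = (redLift cs (longest cs) * redLift cs (longest cs)) ^ n ∧
      c * a = (redLift cs (longest cs) * redLift cs (longest cs)) ^ n := by
  obtain ⟨n, c, hc⟩ := exists_mul_eq_redLift_longest_pow cs a
  refine ⟨n, c, hc, ?_⟩
  apply artinMon_mul_left_cancel cs (c := a)
  rw [← mul_assoc, hc, ((commute_redLift_longest_sq cs a).pow_right n).eq]

/-- The Ore condition for the Artin-Tits monoid of spherical type. -/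
@[reducible]
noncomputable def artinMonOreSet : OreLocalization.OreSet (⊤ : Submonoid (ArtinMon M)) where
  ore_right_cancel r₁ r₂ s h := by
    obtain ⟨n, c, hc, -⟩ := exists_mul_eq_redLift_longest_pow' cs (s : ArtinMon M)
    refine ⟨⟨_, Submonoid.mem_top
      ((redLift cs (longest cs) * redLift cs (longest cs)) ^ n)⟩, ?_⟩
    change _ ^ n * r₁ = _ ^ n * r₂
    rw [← ((commute_redLift_longest_sq cs r₁).pow_right n).eq,
      ← ((commute_redLift_longest_sq cs r₂).pow_right n).eq, ← hc, ← mul_assoc, h, mul_assoc]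
  oreNum r s := r * (exists_mul_eq_redLift_longest_pow' cs (s : ArtinMon M)).choose_spec.choose
  oreDenom _ s := ⟨(redLift cs (longest cs) * redLift cs (longest cs)) ^
    (exists_mul_eq_redLift_longest_pow' cs (s : ArtinMon M)).choose, Submonoid.mem_top _⟩
  ore_eq r s := by
    have h := (exists_mul_eq_redLift_longest_pow' cs (s : ArtinMon M)).choose_spec.choose_spec.2
    rw [mul_assoc, h]
    exact ((commute_redLift_longest_sq cs r).pow_right _).eq.symm

theorem exists_group_embedding (M : CoxeterMatrix B) [Finite M.Group] :
    ∃ (f : B → Units (@OreLocalization (ArtinMon M) _ ⊤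
        (artinMonOreSet M.toCoxeterSystem) (ArtinMon M) _)),
      (∀ r ∈ braidRels M, FreeGroup.lift f r = 1) ∧
      ∀ ω ω' : List B, (ω.map f).prod = (ω'.map f).prod → monWord M ω = monWord M ω' := by
  let _ := artinMonOreSet M.toCoxeterSystem
  let N : ArtinMon M →* OreLocalization (⊤ : Submonoid (ArtinMon M)) (ArtinMon M) :=
    OreLocalization.numeratorHom
  let f : B → Units (OreLocalization (⊤ : Submonoid (ArtinMon M)) (ArtinMon M)) :=
    fun s => OreLocalization.numeratorUnit ⟨monGen M s, Submonoid.mem_top _⟩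
  have hval : ∀ ω : List B, (((ω.map f).prod : Units _) : OreLocalization _ _) =
      N (monWord M ω) := by
    intro ω
    induction ω with
    | nil => rw [monWord_nil, map_one]; rfl
    | cons s ω ih =>
      rw [List.map_cons, List.prod_cons, Units.val_mul, ih, monWord_cons, map_mul]
      rfl
  have hinj : Function.Injective N := by
    intro a b h
    have h' : a /ₒ (1 : (⊤ : Submonoid (ArtinMon M))) = b /ₒ 1 := h
    rw [OreLocalization.oreDiv_eq_iff] at h'
    obtain ⟨u, v, h1, h2⟩ := h'
    simp only [Submonoid.coe_one, mul_one] at h2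
    rw [Submonoid.smul_def, h2, smul_eq_mul, smul_eq_mul] at h1
    exact (artinMon_mul_left_cancel M.toCoxeterSystem h1).symm
  refine ⟨f, ?_, ?_⟩
  · rintro _ ⟨s, t, hst, h0, rfl⟩
    rw [map_mul, map_inv, mul_inv_eq_one, map_list_prod, map_list_prod, List.map_map,
      List.map_map]
    have e : (⇑(FreeGroup.lift f) ∘ FreeGroup.of) = f := by
      funext s; simp
    rw [e]
    apply Units.ext
    rw [hval, hval, monWord_altList M hst h0]
  · intro ω ω' h
    apply hinj
    rw [← hval, ← hval, h]

/-- Words which are equal in the Artin-Tits group of spherical type are equal in the monoid. -/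
theorem monWord_eq_of_prod_gen_eq (M : CoxeterMatrix B) [Finite M.Group] {ω ω' : List B}
    (h : (ω.map (gen M)).prod = (ω'.map (gen M)).prod) : monWord M ω = monWord M ω' := by
  obtain ⟨f, hf, hinj⟩ := exists_group_embedding M
  apply hinj
  let φ : Artin M →* _ := PresentedGroup.toGroup hf
  have key : ∀ ω : List B, φ ((ω.map (gen M)).prod) = (ω.map f).prod := by
    intro ω
    rw [map_list_prod φ, List.map_map]
    congr 1
    apply List.map_congr_left
    intro s _
    exact PresentedGroup.toGroup.of hf
  rw [← key, ← key, h]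

end Garside

section ArtinBasic

variable (M : CoxeterMatrix B)

theorem artin_closure_range_gen : Subgroup.closure (Set.range (gen M)) = ⊤ :=
  PresentedGroup.closure_range_of (braidRels M)

theorem prod_map_gen_altList {s t : B} (hst : s ≠ t) (h0 : M s t ≠ 0) :
    ((altList s t (M s t)).map (gen M)).prod = ((altList t s (M s t)).map (gen M)).prod := by
  rw [← mul_inv_eq_one]
  have h := PresentedGroup.one_of_mem (rels := braidRels M) ⟨s, t, hst, h0, rfl⟩
  rw [map_mul, map_inv, map_list_prod, map_list_prod, List.map_map, List.map_map] at h
  exact h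

/-- The degree morphism, sending each generator to `1`. -/
def degHom : Artin M →* Multiplicative ℤ :=
  PresentedGroup.toGroup (f := fun _ => Multiplicative.ofAdd (1 : ℤ)) (by
    rintro _ ⟨s, t, hst, h0, rfl⟩
    rw [map_mul, map_inv, mul_inv_eq_one, map_list_prod, map_list_prod, List.map_map,
      List.map_map]
    have : (⇑(FreeGroup.lift fun _ : B => Multiplicative.ofAdd (1 : ℤ)) ∘ FreeGroup.of) =
        fun _ => Multiplicative.ofAdd (1 : ℤ) := by
      funext s; simp
    rw [this, List.map_const', List.map_const', length_altList, length_altList])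

/-- The degree of an element of an Artin-Tits group. -/
def deg (g : Artin M) : ℤ := Multiplicative.toAdd (degHom M g)

theorem deg_mul (g h : Artin M) : deg M (g * h) = deg M g + deg M h := by
  simp [deg]

theorem deg_inv (g : Artin M) : deg M g⁻¹ = -deg M g := by
  simp [deg]

theorem deg_one : deg M 1 = 0 := by simp [deg]

theorem deg_gen (s : B) : deg M (gen M s) = 1 := by
  have : degHom M (gen M s) = Multiplicative.ofAdd (1 : ℤ) := PresentedGroup.toGroup.of _
  rw [deg, this, toAdd_ofAdd]

theorem proj_gen (s : B) : proj M (gen M s) = M.simple s := PresentedGroup.toGroup.of _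

theorem gen_injective : Function.Injective (gen M) := by
  intro s t h
  by_contra hst
  have := congrArg (proj M) h
  rw [proj_gen, proj_gen, ← M.toCoxeterSystem_simple] at this
  exact simple_ne_simple M.toCoxeterSystem hst this

variable {M}

theorem gen_mem_posMonOn {X : Set B} {s : B} (h : s ∈ X) : gen M s ∈ posMonOn M X :=
  Submonoid.subset_closure ⟨s, h, rfl⟩

theorem gen_mem_posMon (s : B) : gen M s ∈ posMon M :=
  Submonoid.subset_closure ⟨s, rfl⟩

theorem posMonOn_mono {X Y : Set B} (h : X ⊆ Y) : posMonOn M X ≤ posMonOn M Y :=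
  Submonoid.closure_mono (Set.image_mono h)

theorem posMonOn_le (X : Set B) : posMonOn M X ≤ posMon M :=
  Submonoid.closure_mono (Set.image_subset_range _ _)

theorem posMon_eq_posMonOn_univ : posMon M = posMonOn M Set.univ := by
  rw [posMon, posMonOn, Set.image_univ]

theorem posMonOn_induction {X : Set B} {p : Artin M → Prop} (h1 : p 1)
    (hmul : ∀ s ∈ X, ∀ g ∈ posMonOn M X, p g → p (gen M s * g)) {g : Artin M}
    (hg : g ∈ posMonOn M X) : p g := by
  induction hg using Submonoid.closure_induction_left with
  | one => exact h1
  | mul_left x hx y hy ih =>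
    obtain ⟨s, hs, rfl⟩ := hx
    exact hmul s hs y hy ih

theorem posMon_induction {p : Artin M → Prop} (h1 : p 1)
    (hmul : ∀ s, ∀ g ∈ posMon M, p g → p (gen M s * g)) {g : Artin M}
    (hg : g ∈ posMon M) : p g := by
  rw [posMon_eq_posMonOn_univ] at hg
  refine posMonOn_induction h1 (fun s _ g hg ih => hmul s g ?_ ih) hg
  rwa [posMon_eq_posMonOn_univ]

theorem exists_gen_mul_of_mem_posMonOn {X : Set B} {g : Artin M} (hg : g ∈ posMonOn M X) :
    g = 1 ∨ ∃ s ∈ X, ∃ h ∈ posMonOn M X, g = gen M s * h :=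
  posMonOn_induction (p := fun g => g = 1 ∨ ∃ s ∈ X, ∃ h ∈ posMonOn M X, g = gen M s * h)
    (Or.inl rfl) (fun s hs g hg _ => Or.inr ⟨s, hs, g, hg, rfl⟩) hg

theorem exists_gen_mul_of_mem_posMon {g : Artin M} (hg : g ∈ posMon M) :
    g = 1 ∨ ∃ s, ∃ h ∈ posMon M, g = gen M s * h :=
  posMon_induction (p := fun g => g = 1 ∨ ∃ s, ∃ h ∈ posMon M, g = gen M s * h)
    (Or.inl rfl) (fun s g hg _ => Or.inr ⟨s, g, hg, rfl⟩) hg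

theorem exists_prod_of_mem_posMon {g : Artin M} (hg : g ∈ posMon M) :
    ∃ ω : List B, (ω.map (gen M)).prod = g :=
  posMon_induction (p := fun g => ∃ ω : List B, (ω.map (gen M)).prod = g)
    ⟨[], rfl⟩ (fun s g _ ⟨ω, h⟩ => ⟨s :: ω, by rw [List.map_cons, List.prod_cons, h]⟩) hg

theorem prod_map_gen_mem_posMonOn {X : Set B} {ω : List B} (h : ∀ s ∈ ω, s ∈ X) :
    (ω.map (gen M)).prod ∈ posMonOn M X := by
  apply Submonoid.list_prod_mem
  intro g hg
  obtain ⟨s, hs, rfl⟩ := List.mem_map.1 hg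
  exact gen_mem_posMonOn (h s hs)

theorem prod_map_gen_mem_posMon (ω : List B) : (ω.map (gen M)).prod ∈ posMon M := by
  rw [posMon_eq_posMonOn_univ]
  exact prod_map_gen_mem_posMonOn fun _ _ => Set.mem_univ _

theorem mem_of_mem_altList {s t x : B} {k : ℕ} (h : x ∈ altList s t k) : x = s ∨ x = t := by
  induction k generalizing s t with
  | zero => simp [altList] at h
  | succ k ih =>
    rcases List.mem_cons.1 h with h | h
    · exact Or.inl h
    · exact (ih h).symm

theorem deg_nonneg {g : Artin M} (hg : g ∈ posMon M) : 0 ≤ deg M g :=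
  posMon_induction (p := fun g => 0 ≤ deg M g) (deg_one M).ge
    (fun s g _ ih => by rw [deg_mul, deg_gen]; omega) hg

theorem eq_one_of_deg_eq_zero {g : Artin M} (hg : g ∈ posMon M) (h : deg M g = 0) : g = 1 := by
  rcases exists_gen_mul_of_mem_posMon hg with h1 | ⟨s, g', hg', rfl⟩
  · exact h1
  · rw [deg_mul, deg_gen] at h
    have := deg_nonneg hg'
    omega

theorem length_proj_le {g : Artin M} (hg : g ∈ posMon M) :
    (M.toCoxeterSystem.length (proj M g) : ℤ) ≤ deg M g :=
  posMon_induction (p := fun g => (M.toCoxeterSystem.length (proj M g) : ℤ) ≤ deg M g)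
    (by simp [deg_one])
    (fun s g _ ih => by
      rw [deg_mul, deg_gen, map_mul, proj_gen]
      have := M.toCoxeterSystem.length_mul_le (M.simple s) (proj M g)
      have h1 : M.toCoxeterSystem.length (M.simple s) = 1 := by
        rw [← M.toCoxeterSystem_simple, CoxeterSystem.length_simple]
      omega) hg

end ArtinBasic

section Reversal

variable (M : CoxeterMatrix B)

theorem reverse_altList (s t : B) (k : ℕ) :
    (altList s t k).reverse = if Even k then altList t s k else altList s t k := by
  have key : CoxeterSystem.alternatingWord t s k =
      if Even k then altList t s k else altList s t k := by
    induction k with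
    | zero => rfl
    | succ k ih =>
      rw [CoxeterSystem.alternatingWord_succ', ih]
      by_cases h : Even k
      · simp [h, Nat.even_add_one, altList]
      · simp [h, Nat.even_add_one, altList]
  rw [← key, altList_eq_reverse_alternatingWord, List.reverse_reverse]

/-- The anti-automorphism fixing the generators, as a morphism to the opposite group. -/
def revHom : Artin M →* (Artin M)ᵐᵒᵖ :=
  PresentedGroup.toGroup (f := fun s => MulOpposite.op (gen M s)) (by
    rintro _ ⟨s, t, hst, h0, rfl⟩
    have key : ∀ ω : List B, FreeGroup.lift (fun s => MulOpposite.op (gen M s))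
        ((ω.map FreeGroup.of).prod) = MulOpposite.op ((ω.reverse.map (gen M)).prod) := by
      intro ω
      rw [map_list_prod, List.map_map, MulOpposite.op_list_prod, List.map_map,
        List.map_reverse, List.reverse_reverse]
      congr 1
    rw [map_mul, map_inv, mul_inv_eq_one, key, key, reverse_altList, reverse_altList]
    split_ifs
    · rw [prod_map_gen_altList M hst h0]
    · rw [prod_map_gen_altList M hst h0])

/-- The anti-automorphism fixing the generators. -/
def rev (g : Artin M) : Artin M := MulOpposite.unop (revHom M g)

variable {M}

theorem rev_mul (g h : Artin M) : rev M (g * h) = rev M h * rev M g := by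
  simp [rev]

theorem rev_one : rev M 1 = 1 := by simp [rev]

theorem rev_inv (g : Artin M) : rev M g⁻¹ = (rev M g)⁻¹ := by simp [rev]

theorem rev_gen (s : B) : rev M (gen M s) = gen M s := by
  have : revHom M (gen M s) = MulOpposite.op (gen M s) := PresentedGroup.toGroup.of _
  rw [rev, this, MulOpposite.unop_op]

theorem rev_rev (g : Artin M) : rev M (rev M g) = g := by
  have hg : g ∈ Subgroup.closure (Set.range (gen M)) := by
    rw [artin_closure_range_gen]; exact Subgroup.mem_top g
  induction hg using Subgroup.closure_induction with
  | mem x hx => obtain ⟨s, rfl⟩ := hx; rw [rev_gen, rev_gen]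
  | one => rw [rev_one, rev_one]
  | mul x y _ _ hx hy => rw [rev_mul, rev_mul, hx, hy]
  | inv x _ hx => rw [rev_inv, rev_inv, hx]

theorem rev_mem_posMonOn {X : Set B} {g : Artin M} (hg : g ∈ posMonOn M X) :
    rev M g ∈ posMonOn M X :=
  posMonOn_induction (p := fun g => rev M g ∈ posMonOn M X)
    (by rw [rev_one]; exact one_mem _)
    (fun s hs g _ ih => by rw [rev_mul, rev_gen]; exact mul_mem ih (gen_mem_posMonOn hs)) hg

theorem rev_mem_posMon {g : Artin M} (hg : g ∈ posMon M) : rev M g ∈ posMon M := by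
  rw [posMon_eq_posMonOn_univ] at *
  exact rev_mem_posMonOn hg

theorem deg_rev {g : Artin M} (hg : g ∈ posMon M) : deg M (rev M g) = deg M g :=
  posMon_induction (p := fun g => deg M (rev M g) = deg M g)
    (by rw [rev_one]) (fun s g _ ih => by rw [rev_mul, rev_gen, deg_mul, deg_mul, ih, add_comm]) hg

end Reversal

section Embedding

variable (M : CoxeterMatrix B)

/-- The morphism from the Artin-Tits monoid to the Artin-Tits group. -/
def toArtin : ArtinMon M →* Artin M :=
  PresentedMonoid.lift (gen M) (by
    rintro _ _ ⟨s, t, hst, h0⟩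
    rw [FreeMonoid.lift_ofList, FreeMonoid.lift_ofList]
    exact prod_map_gen_altList M hst h0)

theorem toArtin_monWord (ω : List B) : toArtin M (monWord M ω) = (ω.map (gen M)).prod := by
  change FreeMonoid.lift (gen M) (FreeMonoid.ofList ω) = _
  rw [FreeMonoid.lift_ofList]

theorem toArtin_monGen (s : B) : toArtin M (monGen M s) = gen M s := by
  have := toArtin_monWord M [s]
  simpa [monWord_cons, monWord_nil] using this

theorem toArtin_mem (a : ArtinMon M) : toArtin M a ∈ posMon M := by
  obtain ⟨ω, rfl⟩ := exists_monWord M a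
  rw [toArtin_monWord]
  exact prod_map_gen_mem_posMon ω

variable {M}

theorem exists_toArtin_eq {g : Artin M} (hg : g ∈ posMon M) : ∃ a, toArtin M a = g := by
  obtain ⟨ω, rfl⟩ := exists_prod_of_mem_posMon hg
  exact ⟨monWord M ω, toArtin_monWord M ω⟩

theorem toArtin_injective [Finite M.Group] : Function.Injective (toArtin M) := by
  intro a b h
  obtain ⟨ω, rfl⟩ := exists_monWord M a
  obtain ⟨ω', rfl⟩ := exists_monWord M b
  rw [toArtin_monWord, toArtin_monWord] at h
  exact monWord_eq_of_prod_gen_eq M h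

end Embedding

section GarsideElement

variable (M : CoxeterMatrix B) [Finite M.Group]

/-- The Garside element of an Artin-Tits group of spherical type. -/
noncomputable def garside : Artin M :=
  toArtin M (redLift M.toCoxeterSystem (longest M.toCoxeterSystem))

theorem garside_mem : garside M ∈ posMon M := toArtin_mem M _

/-- Conjugation of the generators by the Garside element. -/
noncomputable def garsidePerm (s : B) : B := conjLongest M.toCoxeterSystem s

theorem garsidePerm_garsidePerm (s : B) : garsidePerm M (garsidePerm M s) = s :=
  conjLongest_conjLongest _ s

theorem gen_mul_garside (s : B) : gen M s * garside M = garside M * gen M (garsidePerm M s) := by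
  have := congrArg (toArtin M) (monGen_mul_redLift_longest M.toCoxeterSystem s)
  rwa [map_mul, map_mul, toArtin_monGen, toArtin_monGen] at this

theorem exists_gen_mul_eq_garside (s : B) : ∃ c ∈ posMon M, gen M s * c = garside M := by
  have := congrArg (toArtin M) (redLift_longest_eq M.toCoxeterSystem s)
  rw [map_mul, toArtin_monGen] at this
  exact ⟨_, toArtin_mem M _, this⟩

theorem garside_mul_gen (s : B) : garside M * gen M s = gen M (garsidePerm M s) * garside M := by
  rw [gen_mul_garside, garsidePerm_garsidePerm]

theorem commute_garside_sq (g : Artin M) : Commute g (garside M * garside M) := by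
  have hg : g ∈ Subgroup.closure (Set.range (gen M)) := by
    rw [artin_closure_range_gen]; exact Subgroup.mem_top g
  induction hg using Subgroup.closure_induction with
  | mem x hx =>
    obtain ⟨s, rfl⟩ := hx
    rw [Commute, SemiconjBy, ← mul_assoc, gen_mul_garside, mul_assoc, gen_mul_garside,
      garsidePerm_garsidePerm, mul_assoc]
  | one => exact Commute.one_left _
  | mul x y _ _ hx hy => exact hx.mul_left hy
  | inv x _ hx => exact hx.inv_left

theorem garside_squarefree {a b : Artin M} (ha : a ∈ posMon M) (hb : b ∈ posMon M) (s : B) :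
    a * gen M s * gen M s * b ≠ garside M := by
  intro h
  set cs := M.toCoxeterSystem
  obtain ⟨ω, hω, hω'⟩ := cs.exists_isReduced (longest cs)
  have hΔ : garside M = (ω.map (gen M)).prod := by
    rw [garside, hω', redLift_wordProd _ hω, toArtin_monWord]
  have hproj : proj M (garside M) = longest cs := by
    rw [hΔ, hω', map_list_prod, List.map_map, CoxeterSystem.wordProd]
    congr 1
  have hdeg : deg M (garside M) = cs.length (longest cs) := by
    rw [hω', hω, hΔ]
    clear hω hω' hΔ
    induction ω with
    | nil => simp [deg_one]
    | cons s ω ih =>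
      rw [List.map_cons, List.prod_cons, deg_mul, deg_gen, ih, List.length_cons]
      push_cast
      ring
  have h1 : longest cs = proj M a * proj M b := by
    rw [← hproj, ← h, map_mul, map_mul, map_mul, proj_gen, ← M.toCoxeterSystem_simple,
      CoxeterSystem.simple_mul_simple_cancel_right]
  have h2 := cs.length_mul_le (proj M a) (proj M b)
  rw [← h1] at h2
  rw [← h, deg_mul, deg_mul, deg_mul, deg_gen] at hdeg
  have h3 : (cs.length (proj M a) : ℤ) ≤ deg M a := length_proj_le ha
  have h4 : (cs.length (proj M b) : ℤ) ≤ deg M b := length_proj_le hb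
  omega

end GarsideElement

section Divisibility

variable (M : CoxeterMatrix B)

/-- Left divisibility between positive elements. -/
def PosLE (u v : Artin M) : Prop := u ∈ posMon M ∧ u⁻¹ * v ∈ posMon M

variable {M}

namespace PosLE

theorem refl {u : Artin M} (hu : u ∈ posMon M) : PosLE M u u :=
  ⟨hu, by rw [inv_mul_cancel]; exact one_mem _⟩

theorem one_le {u : Artin M} (hu : u ∈ posMon M) : PosLE M 1 u :=
  ⟨one_mem _, by simpa using hu⟩

theorem of_mul_eq {u c v : Artin M} (hu : u ∈ posMon M) (hc : c ∈ posMon M) (h : u * c = v) :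
    PosLE M u v :=
  ⟨hu, by rw [← h, inv_mul_cancel_left]; exact hc⟩

theorem right_mem {u v : Artin M} (h : PosLE M u v) : v ∈ posMon M := by
  simpa using mul_mem h.1 h.2

theorem trans {u v w : Artin M} (h : PosLE M u v) (h' : PosLE M v w) : PosLE M u w :=
  ⟨h.1, by simpa [mul_assoc] using mul_mem h.2 h'.2⟩

theorem inv_mul {u x y : Artin M} (h : PosLE M u x) (h' : PosLE M x y) :
    PosLE M (u⁻¹ * x) (u⁻¹ * y) :=
  ⟨h.2, by simpa [mul_assoc] using h'.2⟩

theorem mul_left_le {u v a : Artin M} (h : PosLE M u a) (h' : PosLE M v (u⁻¹ * a)) :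
    PosLE M u (u * v) ∧ PosLE M (u * v) a :=
  ⟨⟨h.1, by simpa using h'.1⟩, ⟨mul_mem h.1 h'.1, by simpa [mul_assoc] using h'.2⟩⟩

theorem mul_left {u v w : Artin M} (hu : u ∈ posMon M) (h : PosLE M v w) :
    PosLE M (u * v) (u * w) :=
  ⟨mul_mem hu h.1, by simpa [mul_assoc] using h.2⟩

theorem of_mul_left {u v w : Artin M} (hv : v ∈ posMon M) (h : PosLE M (u * v) (u * w)) :
    PosLE M v w :=
  ⟨hv, by simpa [mul_assoc] using h.2⟩

theorem mul_right {u v c : Artin M} (h : PosLE M u v) (hc : c ∈ posMon M) :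
    PosLE M u (v * c) :=
  ⟨h.1, by simpa [mul_assoc] using mul_mem h.2 hc⟩

theorem deg_le {u v : Artin M} (h : PosLE M u v) : deg M u ≤ deg M v := by
  have := deg_nonneg h.2
  rw [deg_mul, deg_inv] at this
  omega

theorem eq_of_deg_le {u v : Artin M} (h : PosLE M u v) (hd : deg M v ≤ deg M u) : u = v := by
  have h1 := deg_nonneg h.2
  have h2 := eq_one_of_deg_eq_zero h.2 (by rw [deg_mul, deg_inv] at *; omega)
  rwa [inv_mul_eq_one] at h2

theorem antisymm {u v : Artin M} (h : PosLE M u v) (h' : PosLE M v u) : u = v :=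
  h.eq_of_deg_le h'.deg_le

end PosLE

theorem posLE_gen_iff_ldvd {s : B} {g : Artin M} : PosLE M (gen M s) g ↔ ldvd M (gen M s) g := by
  constructor
  · intro h
    exact ⟨_, h.2, mul_inv_cancel_left _ _⟩
  · rintro ⟨c, hc, h⟩
    exact PosLE.of_mul_eq (gen_mem_posMon s) hc h

theorem exists_eq_gen_of_deg_eq_one {X : Set B} {g : Artin M} (hg : g ∈ posMonOn M X)
    (h : deg M g = 1) : ∃ s ∈ X, g = gen M s := by
  rcases exists_gen_mul_of_mem_posMonOn hg with rfl | ⟨s, hs, g', hg', rfl⟩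
  · rw [deg_one] at h; omega
  · refine ⟨s, hs, ?_⟩
    rw [deg_mul, deg_gen] at h
    rw [eq_one_of_deg_eq_zero (posMonOn_le X hg') (by omega), mul_one]

theorem exists_mul_gen_of_mem_posMonOn {X : Set B} {g : Artin M} (hg : g ∈ posMonOn M X) :
    g = 1 ∨ ∃ s ∈ X, ∃ h ∈ posMonOn M X, g = h * gen M s := by
  rcases exists_gen_mul_of_mem_posMonOn (rev_mem_posMonOn hg) with h | ⟨s, hs, h, hh, e⟩
  · left
    rw [← rev_rev g, h, rev_one]
  · right
    refine ⟨s, hs, rev M h, rev_mem_posMonOn hh, ?_⟩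
    rw [← rev_rev g, e, rev_mul, rev_gen]

theorem exists_deg_max {D : Artin M → Prop} {N : ℤ} (hD : ∀ g, D g → g ∈ posMon M ∧ deg M g ≤ N)
    {g₀ : Artin M} (h₀ : D g₀) : ∃ d, D d ∧ ∀ g, D g → deg M g ≤ deg M d := by
  set T : Set ℕ := {n | ∃ g, D g ∧ (deg M g).toNat = n} with hT
  have hbdd : BddAbove T := by
    refine ⟨N.toNat, ?_⟩
    rintro _ ⟨g, hg, rfl⟩
    exact Int.toNat_le_toNat (hD g hg).2
  obtain ⟨d, hd, hd'⟩ := Nat.sSup_mem (s := T) ⟨_, g₀, h₀, rfl⟩ hbdd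
  refine ⟨d, hd, fun g hg => ?_⟩
  have h1 : (deg M g).toNat ≤ sSup T := le_csSup hbdd ⟨g, hg, rfl⟩
  rw [← hd'] at h1
  have := deg_nonneg (hD g hg).1
  have := deg_nonneg (hD d hd).1
  omega

variable [Finite M.Group]

theorem PosLE.braid {s t : B} (hst : s ≠ t) {a : Artin M} (hs : PosLE M (gen M s) a)
    (ht : PosLE M (gen M t) a) :
    M s t ≠ 0 ∧ PosLE M ((altList s t (M s t)).map (gen M)).prod a := by
  obtain ⟨c, hc⟩ := exists_toArtin_eq hs.2
  obtain ⟨d, hd⟩ := exists_toArtin_eq ht.2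
  have h1 : toArtin M (monGen M s * c) = a := by rw [map_mul, toArtin_monGen, hc]; simp
  have h2 : toArtin M (monGen M t * d) = a := by rw [map_mul, toArtin_monGen, hd]; simp
  obtain ⟨h0, e, he⟩ := exists_monWord_altList_mul M.toCoxeterSystem hst
    (toArtin_injective (h1.trans h2.symm))
  refine ⟨h0, ?_⟩
  rw [← h1, he, map_mul, toArtin_monWord]
  exact PosLE.of_mul_eq (prod_map_gen_mem_posMon _) (toArtin_mem M e) rfl

theorem exists_lcm_posMonOn {X : Set B} {d e a : Artin M} (hd : d ∈ posMonOn M X)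
    (he : e ∈ posMonOn M X) (hda : PosLE M d a) (hea : PosLE M e a) :
    ∃ l, d⁻¹ * l ∈ posMonOn M X ∧ e⁻¹ * l ∈ posMonOn M X ∧ PosLE M d l ∧ PosLE M e l ∧
      ∀ c, PosLE M d c → PosLE M e c → PosLE M l c := by
  refine exists_lcm_of_local (PosLE M) (fun x => x ∈ posMonOn M X) (gen M '' X)
    (fun g => (deg M g).toNat) (fun x hx => PosLE.refl (posMonOn_le X hx))
    (fun x hx => PosLE.one_le (posMonOn_le X hx)) (fun _ _ _ h h' => h.trans h')
    (fun _ _ _ h h' => h.inv_mul h') (fun _ _ _ h h' => h.mul_left_le h')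
    (one_mem _) (fun x y hx hy => mul_mem hx hy) ?_ ?_ ?_ ?_ hd he hda hea
  · intro g hg
    rcases exists_gen_mul_of_mem_posMonOn hg with h1 | ⟨s, hs, g', hg', rfl⟩
    · exact Or.inl h1
    · refine Or.inr ⟨_, ⟨s, hs, rfl⟩,
        PosLE.of_mul_eq (gen_mem_posMon s) (posMonOn_le X hg') rfl, ?_⟩
      rwa [inv_mul_cancel_left]
  · intro u a h
    have := deg_nonneg h.1
    apply Int.toNat_le_toNat
    rw [deg_mul, deg_inv]
    omega
  · rintro _ ⟨s, -, rfl⟩ a h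
    have := h.deg_le
    change (deg M _).toNat < (deg M _).toNat
    rw [deg_mul, deg_inv]
    rw [deg_gen] at *
    omega
  · rintro _ ⟨s, hs, rfl⟩ _ ⟨t, ht, rfl⟩ a hsa hta
    by_cases hst : s = t
    · subst hst
      refine ⟨_, ?_, ?_, PosLE.refl (gen_mem_posMon s), PosLE.refl (gen_mem_posMon s),
        fun c h _ => h⟩ <;> · rw [inv_mul_cancel]; exact one_mem _
    · have h0 := (PosLE.braid hst hsa hta).1
      have key : ∀ s ∈ X, ∀ t ∈ X, s ≠ t → M s t ≠ 0 →
          (gen M s)⁻¹ * ((altList s t (M s t)).map (gen M)).prod ∈ posMonOn M X := by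
        intro s hs t ht hst h0
        obtain ⟨k, hk⟩ := Nat.exists_eq_succ_of_ne_zero h0
        rw [hk, altList, List.map_cons, List.prod_cons, inv_mul_cancel_left]
        apply prod_map_gen_mem_posMonOn
        intro x hx
        rcases mem_of_mem_altList hx with rfl | rfl <;> assumption
      have h1 := key s hs t ht hst h0
      have h2 := key t ht s hs (Ne.symm hst) (by rwa [M.symmetric t s])
      rw [M.symmetric t s, ← prod_map_gen_altList M hst h0] at h2
      exact ⟨_, h1, h2, ⟨gen_mem_posMon s, posMonOn_le X h1⟩, ⟨gen_mem_posMon t, posMonOn_le X h2⟩,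
        fun c h h' => (PosLE.braid hst h h').2⟩

theorem not_gen_le_of_notMem {X : Set B} {t : B} (ht : t ∉ X) {g : Artin M}
    (hg : g ∈ posMonOn M X) : ¬ PosLE M (gen M t) g := by
  refine posMonOn_induction (p := fun g => ¬ PosLE M (gen M t) g) ?_ ?_ hg
  · intro h
    have := h.deg_le
    rw [deg_gen, deg_one] at this
    omega
  · intro s hs g hg ih h
    have hst : s ≠ t := fun e => ht (e ▸ hs)
    obtain ⟨h0, hb⟩ := PosLE.braid hst
      (PosLE.of_mul_eq (gen_mem_posMon s) (posMonOn_le X hg) rfl) h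
    have h1 : M s t ≠ 1 := M.off_diagonal s t hst
    obtain ⟨k, hk⟩ : ∃ k, M s t = k + 2 := ⟨M s t - 2, by omega⟩
    rw [hk, altList, altList, List.map_cons, List.map_cons, List.prod_cons, List.prod_cons] at hb
    have h2 := hb.of_mul_left (mul_mem (gen_mem_posMon t) (prod_map_gen_mem_posMon _))
    exact ih ((PosLE.of_mul_eq (gen_mem_posMon t) (prod_map_gen_mem_posMon _) rfl).trans h2)

end Divisibility

section Delta

variable (M : CoxeterMatrix B) [Finite M.Group]

theorem exists_delta (Z : Set B) : ∃ d, (d ∈ posMonOn M Z ∧ PosLE M d (garside M)) ∧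
    ∀ g, g ∈ posMonOn M Z ∧ PosLE M g (garside M) → deg M g ≤ deg M d :=
  exists_deg_max (D := fun g => g ∈ posMonOn M Z ∧ PosLE M g (garside M))
    (fun _ hg => ⟨posMonOn_le Z hg.1, hg.2.deg_le⟩)
    ⟨one_mem _, PosLE.one_le (garside_mem M)⟩

/-- The Garside element of a standard parabolic subgroup. -/
noncomputable def delta (Z : Set B) : Artin M := (exists_delta M Z).choose

variable (Z : Set B)

theorem delta_mem : delta M Z ∈ posMonOn M Z := (exists_delta M Z).choose_spec.1.1

theorem delta_mem_posMon : delta M Z ∈ posMon M := posMonOn_le Z (delta_mem M Z)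

theorem delta_le_garside : PosLE M (delta M Z) (garside M) := (exists_delta M Z).choose_spec.1.2

variable {M Z}

theorem le_delta {g : Artin M} (hg : g ∈ posMonOn M Z) (h : PosLE M g (garside M)) :
    PosLE M g (delta M Z) ∧ g⁻¹ * delta M Z ∈ posMonOn M Z := by
  obtain ⟨l, h1, h2, h3, h4, h5⟩ :=
    exists_lcm_posMonOn (delta_mem M Z) hg (delta_le_garside M Z) h
  have hl : delta M Z = l := by
    apply h3.eq_of_deg_le
    refine (exists_delta M Z).choose_spec.2 l ⟨?_, h5 _ (delta_le_garside M Z) h⟩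
    simpa using mul_mem (delta_mem M Z) h1
  rw [hl]
  exact ⟨h4, h2⟩

theorem gen_le_delta {z : B} (hz : z ∈ Z) :
    PosLE M (gen M z) (delta M Z) ∧ (gen M z)⁻¹ * delta M Z ∈ posMonOn M Z := by
  obtain ⟨c, hc, h⟩ := exists_gen_mul_eq_garside M z
  exact le_delta (gen_mem_posMonOn hz) (PosLE.of_mul_eq (gen_mem_posMon z) hc h)

theorem delta_mono {Y : Set B} (h : Y ⊆ Z) : PosLE M (delta M Y) (delta M Z) :=
  (le_delta (posMonOn_mono h (delta_mem M Y)) (delta_le_garside M Y)).1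

theorem exists_gen_mul_delta {z : B} (hz : z ∈ Z) :
    ∃ z' ∈ Z, gen M z * delta M Z = delta M Z * gen M z' := by
  obtain ⟨p, hpd⟩ : ∃ p, p = (gen M z)⁻¹ * delta M Z := ⟨_, rfl⟩
  obtain ⟨q, hqd⟩ : ∃ q, q = (delta M Z)⁻¹ * garside M := ⟨_, rfl⟩
  have hp := (gen_le_delta (M := M) hz).2
  have hq := (delta_le_garside M Z).2
  rw [← hpd] at hp
  rw [← hqd] at hq
  have hd : delta M Z = gen M z * p := by rw [hpd]; group
  have hΔ : garside M = gen M z * (p * q) := by rw [hpd, hqd]; group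
  have h2 : garside M = p * (q * gen M (garsidePerm M z)) := by
    have h1 := (gen_mul_garside M z).trans (congrArg (· * gen M (garsidePerm M z)) hΔ)
    simpa only [mul_assoc, mul_right_inj] using h1
  have hpΔ : PosLE M p (garside M) :=
    PosLE.of_mul_eq (posMonOn_le Z hp) (mul_mem hq (gen_mem_posMon (garsidePerm M z))) h2.symm
  obtain ⟨z', hz', he⟩ := exists_eq_gen_of_deg_eq_one (le_delta hp hpΔ).2 (by
    rw [deg_mul, deg_inv, hpd, deg_mul, deg_inv, deg_gen]; ring)
  refine ⟨z', hz', ?_⟩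
  rw [← he, hd]
  group

theorem exists_delta_mul_gen [Finite B] {z' : B} (hz' : z' ∈ Z) :
    ∃ z ∈ Z, gen M z * delta M Z = delta M Z * gen M z' := by
  choose f hf hf' using fun z : Z => exists_gen_mul_delta (M := M) z.2
  have hinj : Function.Injective (fun z : Z => (⟨f z, hf z⟩ : Z)) := by
    intro x y hxy
    have h : f x = f y := congrArg Subtype.val hxy
    have h1 := hf' x
    rw [h, ← hf' y, mul_left_inj] at h1
    exact Subtype.ext (gen_injective M h1)
  obtain ⟨z, hz⟩ := Finite.surjective_of_injective hinj ⟨z', hz'⟩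
  refine ⟨z, z.2, ?_⟩
  rw [hf' z]
  have : f z = z' := congrArg Subtype.val hz
  rw [this]

theorem delta_squarefree {a b : Artin M} (ha : a ∈ posMon M) (hb : b ∈ posMon M) (s : B) :
    a * gen M s * gen M s * b ≠ delta M Z := by
  intro h
  apply garside_squarefree M ha (mul_mem hb (delta_le_garside M Z).2) s
  rw [← mul_assoc, h, mul_inv_cancel_left]

variable [Finite B]

theorem eq_delta_of_forall_le {f : Artin M} (hf : f ∈ posMonOn M Z)
    (hfΔ : PosLE M f (garside M)) (h : ∀ z ∈ Z, PosLE M (gen M z) f) : f = delta M Z := by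
  have hc := (le_delta hf hfΔ).2
  rcases exists_mul_gen_of_mem_posMonOn hc with h1 | ⟨y, hy, c, hc', e⟩
  · rwa [inv_mul_eq_one] at h1
  · exfalso
    obtain ⟨x, hx, hxy⟩ := exists_delta_mul_gen (M := M) hy
    have hx' := h x hx
    rw [inv_mul_eq_iff_eq_mul] at e
    have h2 : (gen M x)⁻¹ * f * c * gen M y * gen M y * 1 = delta M Z := by
      rw [mul_one, ← mul_right_inj (gen M x), hxy, e]
      group
    exact delta_squarefree (mul_mem hx'.2 (posMonOn_le Z hc')) (one_mem _) y h2

theorem delta_le_of_forall_le {c : Artin M} (hc : c ∈ posMon M)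
    (h : ∀ z ∈ Z, PosLE M (gen M z) c) : PosLE M (delta M Z) c := by
  obtain ⟨f, ⟨hf, hfd, hfc⟩, hmax⟩ := exists_deg_max
    (D := fun g => g ∈ posMonOn M Z ∧ PosLE M g (delta M Z) ∧ PosLE M g c)
    (N := deg M c) (fun g hg => ⟨posMonOn_le Z hg.1, hg.2.2.deg_le⟩)
    (g₀ := 1) ⟨one_mem _, PosLE.one_le (delta_mem_posMon M Z), PosLE.one_le hc⟩
  have hz : ∀ z ∈ Z, PosLE M (gen M z) f := by
    intro z hz
    obtain ⟨l, h1, h2, h3, h4, h5⟩ :=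
      exists_lcm_posMonOn hf (gen_mem_posMonOn hz) hfd (gen_le_delta hz).1
    have hl : f = l := by
      apply h3.eq_of_deg_le
      exact hmax l ⟨by simpa using mul_mem hf h1, h5 _ hfd (gen_le_delta hz).1, h5 _ hfc (h z hz)⟩
    rw [hl]
    exact h4
  rw [← eq_delta_of_forall_le hf (hfd.trans (delta_le_garside M Z)) hz]
  exact hfc

theorem isDelta_delta : IsDelta M Z (delta M Z) := by
  refine ⟨delta_mem M Z, fun s hs => ⟨_, (gen_le_delta hs).2, mul_inv_cancel_left _ _⟩, ?_⟩
  intro m hm h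
  have hmP := posMonOn_le Z hm
  have hle := delta_le_of_forall_le hmP (Z := Z) (fun z hz => by
    obtain ⟨c, hc, e⟩ := h z hz
    exact PosLE.of_mul_eq (gen_mem_posMon z) (posMonOn_le Z hc) e)
  obtain ⟨l, h1, h2, h3, h4, h5⟩ :=
    exists_lcm_posMonOn (delta_mem M Z) hm hle (PosLE.refl hmP)
  have := (h5 m hle (PosLE.refl hmP)).antisymm h4
  rw [this] at h1
  exact ⟨_, h1, mul_inv_cancel_left _ _⟩

theorem isDelta_iff {d : Artin M} : IsDelta M Z d ↔ d = delta M Z := by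
  constructor
  · rintro ⟨h1, h2, h3⟩
    obtain ⟨g1, g2, g3⟩ := isDelta_delta (M := M) (Z := Z)
    obtain ⟨c, hc, e⟩ := h3 _ g1 g2
    obtain ⟨c', hc', e'⟩ := g3 _ h1 h2
    exact (PosLE.of_mul_eq (posMonOn_le Z h1) (posMonOn_le Z hc) e).antisymm
      (PosLE.of_mul_eq (posMonOn_le Z g1) (posMonOn_le Z hc') e')
  · rintro rfl
    exact isDelta_delta

theorem rev_delta : rev M (delta M Z) = delta M Z := by
  refine ((delta_le_of_forall_le (rev_mem_posMon (delta_mem_posMon M Z)) ?_).eq_of_deg_le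
    (deg_rev (delta_mem_posMon M Z)).le).symm
  intro z hz
  obtain ⟨z', hz', h⟩ := exists_delta_mul_gen (M := M) hz
  have h2 : (gen M z')⁻¹ * delta M Z * gen M z = delta M Z := by
    rw [mul_assoc, ← h, inv_mul_cancel_left]
  refine PosLE.of_mul_eq (gen_mem_posMon z)
    (rev_mem_posMon (gen_le_delta hz').1.2) ?_
  rw [← rev_gen z, ← rev_mul, h2]

end Delta

section Conjugators

variable {M : CoxeterMatrix B} {X Y Z : Set B}

theorem mem_conjPos_iff {g : Artin M} : g ∈ conjPos M X Y ↔ g ∈ posMon M ∧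
    (∀ x ∈ X, ∃ y ∈ Y, gen M y * g = g * gen M x) ∧
    ∀ y ∈ Y, ∃ x ∈ X, gen M y * g = g * gen M x := by
  constructor
  · rintro ⟨hg, h⟩
    refine ⟨hg, fun x hx => ?_, fun y hy => ?_⟩
    · have : g * gen M x ∈ leftMul M Y g := h ▸ ⟨x, hx, rfl⟩
      exact this
    · have : gen M y * g ∈ rightMul M X g := h ▸ ⟨y, hy, rfl⟩
      obtain ⟨x, hx, e⟩ := this
      exact ⟨x, hx, e.symm⟩
  · rintro ⟨hg, h1, h2⟩
    refine ⟨hg, Set.Subset.antisymm ?_ ?_⟩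
    · rintro _ ⟨x, hx, rfl⟩
      exact h1 x hx
    · rintro _ ⟨y, hy, rfl⟩
      obtain ⟨x, hx, e⟩ := h2 y hy
      exact ⟨x, hx, e.symm⟩

theorem one_mem_conjPos : (1 : Artin M) ∈ conjPos M X X :=
  mem_conjPos_iff.2 ⟨one_mem _, fun x hx => ⟨x, hx, by simp⟩, fun x hx => ⟨x, hx, by simp⟩⟩

theorem eq_of_one_mem_conjPos (h : (1 : Artin M) ∈ conjPos M X Y) : X = Y := by
  obtain ⟨-, h1, h2⟩ := mem_conjPos_iff.1 h
  ext x
  constructor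
  · intro hx
    obtain ⟨y, hy, e⟩ := h1 x hx
    rw [mul_one, one_mul] at e
    exact gen_injective M e ▸ hy
  · intro hx
    obtain ⟨y, hy, e⟩ := h2 x hx
    rw [mul_one, one_mul] at e
    exact gen_injective M e ▸ hy

theorem mul_mem_conjPos {g h : Artin M} (hg : g ∈ conjPos M X Y) (hh : h ∈ conjPos M Y Z) :
    h * g ∈ conjPos M X Z := by
  rw [mem_conjPos_iff] at *
  refine ⟨mul_mem hh.1 hg.1, fun x hx => ?_, fun z hz => ?_⟩
  · obtain ⟨y, hy, e⟩ := hg.2.1 x hx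
    obtain ⟨z, hz, e'⟩ := hh.2.1 y hy
    exact ⟨z, hz, by rw [← mul_assoc, e', mul_assoc, e, mul_assoc]⟩
  · obtain ⟨y, hy, e⟩ := hh.2.2 z hz
    obtain ⟨x, hx, e'⟩ := hg.2.2 y hy
    exact ⟨x, hx, by rw [← mul_assoc, e, mul_assoc, e', mul_assoc]⟩

theorem mem_conjPos_of_mul_left {g h : Artin M} (hgh : h * g ∈ conjPos M X Z)
    (hg : g ∈ conjPos M X Y) (hh : h ∈ posMon M) : h ∈ conjPos M Y Z := by
  rw [mem_conjPos_iff] at *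
  refine ⟨hh, fun y hy => ?_, fun z hz => ?_⟩
  · obtain ⟨x, hx, e⟩ := hg.2.2 y hy
    obtain ⟨z, hz, e'⟩ := hgh.2.1 x hx
    refine ⟨z, hz, mul_right_cancel (b := g) ?_⟩
    rw [mul_assoc, e', mul_assoc, mul_assoc, e]
  · obtain ⟨x, hx, e⟩ := hgh.2.2 z hz
    obtain ⟨y, hy, e'⟩ := hg.2.1 x hx
    refine ⟨y, hy, mul_right_cancel (b := g) ?_⟩
    rw [mul_assoc, e, mul_assoc, mul_assoc, e']

theorem mem_conjPos_of_mul_right {g h : Artin M} (hgh : h * g ∈ conjPos M X Z)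
    (hh : h ∈ conjPos M Y Z) (hg : g ∈ posMon M) : g ∈ conjPos M X Y := by
  rw [mem_conjPos_iff] at *
  refine ⟨hg, fun x hx => ?_, fun y hy => ?_⟩
  · obtain ⟨z, hz, e⟩ := hgh.2.1 x hx
    obtain ⟨y, hy, e'⟩ := hh.2.2 z hz
    refine ⟨y, hy, mul_left_cancel (a := h) ?_⟩
    rw [← mul_assoc, ← e', mul_assoc, e, mul_assoc]
  · obtain ⟨z, hz, e⟩ := hh.2.1 y hy
    obtain ⟨x, hx, e'⟩ := hgh.2.2 z hz
    refine ⟨x, hx, mul_left_cancel (a := h) ?_⟩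
    rw [← mul_assoc, ← e, mul_assoc, e', mul_assoc]

theorem rev_gen_mul_eq {x y : B} {g : Artin M} (h : gen M y * g = g * gen M x) :
    gen M x * rev M g = rev M g * gen M y := by
  have := congrArg (rev M) h
  rw [rev_mul, rev_mul, rev_gen, rev_gen] at this
  exact this.symm

theorem commute_gen_of_eq_two {s t : B} (h : M s t = 2) : Commute (gen M s) (gen M t) := by
  have hst : s ≠ t := by
    rintro rfl
    rw [M.diagonal] at h
    omega
  have := prod_map_gen_altList M hst (by omega)
  simpa [h, altList, commute_iff_eq] using this

theorem mem_comp_self (t : B) (h : t ∈ Z) : t ∈ comp M Z t := ⟨h, .refl⟩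

theorem eq_two_of_notMem_comp {t x z : B} (hx : x ∈ Z) (hx' : x ∉ comp M Z t)
    (hz : z ∈ comp M Z t) : M x z = 2 := by
  by_contra h
  exact hx' ⟨hx, hz.2.tail ⟨hz.1, hx, fun e => hx' (e ▸ hz), by rwa [M.symmetric]⟩⟩

theorem commute_gen_of_notMem_comp {t x : B} (hx : x ∈ Z) (hx' : x ∉ comp M Z t)
    {g : Artin M} (hg : g ∈ posMonOn M (comp M Z t)) : Commute (gen M x) g :=
  posMonOn_induction (p := fun g => Commute (gen M x) g) (Commute.one_right _)
    (fun _ hs _ _ ih => (commute_gen_of_eq_two (eq_two_of_notMem_comp hx hx' hs)).mul_right ih) hg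

theorem exists_mul_eq_of_mem_posMonOn {g : Artin M}
    (hX : ∀ x ∈ X, ∃ y, gen M x * g = g * gen M y) {u : Artin M} (hu : u ∈ posMonOn M X) :
    ∃ v ∈ posMon M, u * g = g * v := by
  refine posMonOn_induction (p := fun u => ∃ v ∈ posMon M, u * g = g * v)
    ⟨1, one_mem _, by simp⟩ ?_ hu
  rintro s hs u - ⟨v, hv, e⟩
  obtain ⟨y, hy⟩ := hX s hs
  exact ⟨gen M y * v, mul_mem (gen_mem_posMon y) hv,
    by rw [mul_assoc, e, ← mul_assoc, hy, mul_assoc]⟩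

end Conjugators

section Ribbons

variable [Finite B] {M : CoxeterMatrix B} [Finite M.Group] {X Y Z : Set B}

theorem gen_delta_comm {z z' : B} (h : gen M z * delta M Z = delta M Z * gen M z') :
    gen M z' * delta M Z = delta M Z * gen M z := by
  simpa only [rev_delta] using rev_gen_mul_eq h

theorem mul_inv_mem_of_delta_subset (h : Y ⊆ Z) : delta M Z * (delta M Y)⁻¹ ∈ posMon M := by
  have := rev_mem_posMon (delta_mono (M := M) h).2
  rwa [rev_mul, rev_inv, rev_delta, rev_delta] at this

theorem IsElemRibbon.mem_conjPos {g : Artin M} (h : IsElemRibbon M X Y g) :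
    g ∈ conjPos M X Y := by
  obtain ⟨t, -, h1, -, h2⟩ := h
  refine ⟨?_, h2.symm⟩
  rcases h1 with ⟨-, hd⟩ | ⟨-, d₁, d₂, hd₁, hd₂, rfl⟩
  · rw [isDelta_iff.1 hd]
    exact delta_mem_posMon M _
  · rw [isDelta_iff.1 hd₁, isDelta_iff.1 hd₂]
    exact mul_inv_mem_of_delta_subset Set.sdiff_subset

theorem IsRibbon.mem_conjPos {g : Artin M} (h : IsRibbon M X Y g) : g ∈ conjPos M X Y := by
  induction h with
  | nil => exact one_mem_conjPos
  | cons _ h ih => exact mul_mem_conjPos ih h.mem_conjPos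

omit [Finite B] [Finite M.Group] in
theorem IsRibbon.mul_elemRibbon {g d : Artin M} (hg : IsRibbon M Y Z g)
    (hd : IsElemRibbon M X Y d) : IsRibbon M X Z (g * d) := by
  induction hg with
  | nil =>
    rw [one_mul, ← mul_one d]
    exact .cons (.nil _) hd
  | cons _ h ih =>
    rw [mul_assoc]
    exact .cons ih h

/-- The set to which an elementary ribbon conjugates `X` always exists. -/
theorem exists_isElemRibbon {t : B} {d : Artin M}
    (h : (t ∈ X ∧ d = delta M (comp M (X ∪ {t}) t)) ∨
      (t ∉ X ∧ d = delta M (comp M (X ∪ {t}) t) *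
        (delta M (comp M (X ∪ {t}) t \ {t}))⁻¹)) :
    ∃ Y, IsElemRibbon M X Y d := by
  have key : ∀ x ∈ X, ∃ y ∈ X ∪ {t}, gen M y * d = d * gen M x := by
    intro x hx
    by_cases hxc : x ∈ comp M (X ∪ {t}) t
    · rcases h with ⟨-, rfl⟩ | ⟨ht, rfl⟩
      · obtain ⟨y, hy, e⟩ := exists_delta_mul_gen (M := M) hxc
        exact ⟨y, hy.1, e⟩
      · obtain ⟨x', hx', e⟩ := exists_gen_mul_delta (M := M)
          (Z := comp M (X ∪ {t}) t \ {t}) ⟨hxc, fun e => ht (e ▸ hx)⟩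
        obtain ⟨y, hy, e'⟩ := exists_delta_mul_gen (M := M) hx'.1
        refine ⟨y, hy.1, ?_⟩
        rw [← mul_assoc, e', mul_assoc, mul_assoc, mul_right_inj, mul_inv_eq_iff_eq_mul,
          mul_assoc, e, inv_mul_cancel_left]
    · have hcomm : ∀ Z ⊆ comp M (X ∪ {t}) t, Commute (gen M x) (delta M Z) := fun Z hZ =>
        commute_gen_of_notMem_comp (Set.mem_union_left _ hx) hxc (posMonOn_mono hZ (delta_mem M Z))
      refine ⟨x, Or.inl hx, ?_⟩
      rcases h with ⟨-, rfl⟩ | ⟨-, rfl⟩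
      · exact hcomm _ le_rfl
      · exact (hcomm _ le_rfl).mul_right (hcomm _ Set.sdiff_subset).inv_right
  refine ⟨{y | ∃ x ∈ X, gen M y * d = d * gen M x}, t, Subtype.finite, ?_, ?_, ?_⟩
  · rcases h with ⟨ht, h⟩ | ⟨ht, h⟩
    · exact Or.inl ⟨ht, isDelta_iff.2 h⟩
    · exact Or.inr ⟨ht, _, _, isDelta_delta, isDelta_delta, h⟩
  · rintro y ⟨x, hx, e⟩
    obtain ⟨y', hy', e'⟩ := key x hx
    rw [← e', mul_left_inj] at e
    exact gen_injective M e ▸ hy'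
  · apply Set.Subset.antisymm
    · rintro _ ⟨y, ⟨x, hx, e⟩, rfl⟩
      exact ⟨x, hx, e.symm⟩
    · rintro _ ⟨x, hx, rfl⟩
      obtain ⟨y, -, e⟩ := key x hx
      exact ⟨y, ⟨x, hx, e⟩, e⟩

omit [Finite B] in
theorem gen_le_of_edge {a b a' b' : B} {g : Artin M} (hg : PosLE M (gen M a) g)
    (ha : gen M a * g = g * gen M a') (hb : gen M b * g = g * gen M b')
    (hab : a ≠ b) (h2 : M a b ≠ 2) : PosLE M (gen M b) g := by
  have h1 : PosLE M (gen M a) (gen M b * g) := by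
    rw [hb]
    exact hg.mul_right (gen_mem_posMon b')
  obtain ⟨h0, hb'⟩ := PosLE.braid hab.symm
    (PosLE.of_mul_eq (gen_mem_posMon b) hg.right_mem rfl) h1
  have h3 : M b a ≠ 1 := M.off_diagonal b a hab.symm
  rw [M.symmetric] at h2
  obtain ⟨k, hk⟩ : ∃ k, M b a = k + 3 := ⟨M b a - 3, by omega⟩
  simp only [hk, altList, List.map_cons, List.prod_cons] at hb'
  have hr := prod_map_gen_mem_posMon (M := M) (altList a b k)
  have h4 := hb'.of_mul_left
    (mul_mem (gen_mem_posMon a) (mul_mem (gen_mem_posMon b) hr))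
  have h5 : PosLE M (gen M a * gen M b) g :=
    (PosLE.of_mul_eq (mul_mem (gen_mem_posMon a) (gen_mem_posMon b)) hr (mul_assoc _ _ _)).trans h4
  have h6 : PosLE M (gen M a * gen M b) (gen M a * g) := by
    rw [ha]
    exact h5.mul_right (gen_mem_posMon a')
  exact h6.of_mul_left (gen_mem_posMon b)

theorem exists_elemRibbon_rdvd {t : B} {g : Artin M}
    (hX : ∀ x ∈ X, ∃ y, gen M x * g = g * gen M y) (ht : PosLE M (gen M t) g) :
    ∃ Y d, IsElemRibbon M X Y d ∧ d ≠ 1 ∧ PosLE M (rev M d) g := by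
  have htc : t ∈ comp M (X ∪ {t}) t := mem_comp_self t (Or.inr rfl)
  by_cases htX : t ∈ X
  · obtain ⟨Y, hY⟩ := exists_isElemRibbon (M := M) (Or.inl ⟨htX, rfl⟩)
    refine ⟨Y, _, hY, ?_, ?_⟩
    · intro h
      have := (gen_le_delta (M := M) htc).1.deg_le
      rw [h, deg_one, deg_gen] at this
      omega
    · rw [rev_delta]
      refine delta_le_of_forall_le ht.right_mem ?_
      have hsub : X ∪ {t} = X := by simp [htX]
      rintro z ⟨-, hz⟩
      induction hz with
      | refl => exact ht
      | tail _ h ih =>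
        rw [hsub] at h
        obtain ⟨y, hy⟩ := hX _ h.1
        obtain ⟨y', hy'⟩ := hX _ h.2.1
        exact gen_le_of_edge ih hy hy' h.2.2.1 h.2.2.2
  · obtain ⟨Y, hY⟩ := exists_isElemRibbon (M := M) (Or.inr ⟨htX, rfl⟩)
    refine ⟨Y, _, hY, ?_, ?_⟩
    · intro h
      rw [mul_inv_eq_one] at h
      have := (gen_le_delta (M := M) htc).1
      rw [h] at this
      exact not_gen_le_of_notMem (by simp) (delta_mem M _) this
    · rw [rev_mul, rev_inv, rev_delta, rev_delta]
      have hsub : comp M (X ∪ {t}) t \ {t} ⊆ X := by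
        rintro z ⟨hz, hzt⟩
        exact hz.1.resolve_right hzt
      refine ⟨(delta_mono Set.sdiff_subset).2, ?_⟩
      have : PosLE M (delta M (comp M (X ∪ {t}) t))
          (delta M (comp M (X ∪ {t}) t \ {t}) * g) := by
        refine delta_le_of_forall_le (mul_mem (delta_mem_posMon M _) ht.right_mem) ?_
        intro z hz
        by_cases hzt : z = t
        · subst hzt
          obtain ⟨v, hv, e⟩ := exists_mul_eq_of_mem_posMonOn hX
            (posMonOn_mono hsub (delta_mem M _))
          rw [e]
          exact ht.mul_right hv
        · exact (gen_le_delta (Z := comp M (X ∪ {t}) t \ {t}) ⟨hz, hzt⟩).1.mul_right ht.right_mem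
      simpa [mul_assoc] using this.2

theorem isRibbon_of_mem_conjPos {g : Artin M} (hg : g ∈ conjPos M X Y) : IsRibbon M X Y g := by
  obtain ⟨n, hn⟩ : ∃ n : ℕ, (deg M g).toNat = n := ⟨_, rfl⟩
  induction n using Nat.strong_induction_on generalizing X g with
  | _ n ih =>
    obtain ⟨hP, h1, h2⟩ := mem_conjPos_iff.1 hg
    rcases exists_gen_mul_of_mem_posMon (rev_mem_posMon hP) with h | ⟨t, r, hr, e⟩
    · have : g = 1 := by rw [← rev_rev g, h, rev_one]
      subst this
      rw [eq_of_one_mem_conjPos hg]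
      exact .nil Y
    · obtain ⟨X', d, hd, hd1, hle⟩ := exists_elemRibbon_rdvd (X := X) (t := t) (g := rev M g)
        (fun x hx => by
          obtain ⟨y, -, e⟩ := h1 x hx
          exact ⟨y, rev_gen_mul_eq e⟩)
        (PosLE.of_mul_eq (gen_mem_posMon t) hr e.symm)
      have hh := rev_mem_posMon hle.2
      rw [rev_mul, rev_inv, rev_rev, rev_rev] at hh
      obtain ⟨h, hh'⟩ : ∃ h, h = g * d⁻¹ := ⟨_, rfl⟩
      rw [← hh'] at hh
      obtain rfl : g = h * d := by rw [hh']; group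
      have hdc := hd.mem_conjPos
      refine IsRibbon.mul_elemRibbon
        (ih (deg M h).toNat ?_ (mem_conjPos_of_mul_left hg hdc hh) rfl) hd
      have hdeg := deg_mul M h d
      have h3 := deg_nonneg hdc.1
      have h4 : deg M d ≠ 0 := fun h0 => hd1 (eq_one_of_deg_eq_zero hdc.1 h0)
      have h5 := deg_nonneg hh
      omega

theorem isRibbon_iff {g : Artin M} : IsRibbon M X Y g ↔ g ∈ conjPos M X Y :=
  ⟨IsRibbon.mem_conjPos, isRibbon_of_mem_conjPos⟩

end Ribbons

section Reduced

variable {M : CoxeterMatrix B} {X : Set B} [Finite M.Group]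

theorem gen_mul_le {s s' : B} {g c : Artin M} (hg : g ∈ posMon M)
    (hs : gen M s * g = g * gen M s') (hn : ¬ PosLE M (gen M s) g) (hsc : PosLE M (gen M s) c)
    (hgc : PosLE M g c) : PosLE M (gen M s * g) c := by
  have hu : ∀ {a : Artin M}, a ∈ posMon M → a ∈ posMonOn M Set.univ :=
    fun h => posMon_eq_posMonOn_univ (M := M) ▸ h
  obtain ⟨l, -, -, h3, h4, h5⟩ := exists_lcm_posMonOn (hu (gen_mem_posMon s)) (hu hg) hsc hgc
  have hl := h5 (gen M s * g) (PosLE.of_mul_eq (gen_mem_posMon s) hg rfl)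
    (PosLE.of_mul_eq hg (gen_mem_posMon s') hs.symm)
  have hne : deg M g < deg M l := by
    by_contra hlt
    rw [← h4.eq_of_deg_le (not_lt.1 hlt)] at h3
    exact hn h3
  rw [← hl.eq_of_deg_le (by rw [deg_mul, deg_gen]; omega)]
  exact h5 c hsc hgc

theorem gen_le_of_le_mul {s s' : B} {g h : Artin M} (hg : g ∈ posMon M)
    (hh : h ∈ posMon M) (hs : gen M s * g = g * gen M s') (hn : ¬ PosLE M (gen M s) g)
    (hsc : PosLE M (gen M s) (g * h)) : PosLE M (gen M s') h := by
  have := gen_mul_le hg hs hn hsc (PosLE.of_mul_eq hg hh rfl)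
  rw [hs] at this
  exact this.of_mul_left (gen_mem_posMon s')

variable (M X) in
/-- The submonoid of `X`-reduced positive elements normalizing `X`. -/
def reducedConj : Submonoid (Artin M) where
  carrier := {g | g ∈ conjPos M X X ∧ lreduced M X g}
  one_mem' := by
    refine ⟨one_mem_conjPos, fun s _ h => ?_⟩
    have := (posLE_gen_iff_ldvd.2 h).deg_le
    rw [deg_gen, deg_one] at this
    omega
  mul_mem' := by
    rintro g h ⟨hg, hgr⟩ ⟨hh, hhr⟩
    refine ⟨mul_mem_conjPos hh hg, fun s hs hd => ?_⟩
    obtain ⟨s', hs', e⟩ := (mem_conjPos_iff.1 hg).2.2 s hs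
    exact hhr s' hs' (posLE_gen_iff_ldvd.1 (gen_le_of_le_mul hg.1 hh.1 e
      (fun h => hgr s hs (posLE_gen_iff_ldvd.1 h)) (posLE_gen_iff_ldvd.2 hd)))

theorem mem_reducedConj {g : Artin M} :
    g ∈ reducedConj M X ↔ g ∈ conjPos M X X ∧ ∀ s ∈ X, ¬ PosLE M (gen M s) g := by
  simp only [posLE_gen_iff_ldvd]
  exact Iff.rfl

theorem inv_mul_mem_reducedConj {g c : Artin M} (hg : g ∈ reducedConj M X)
    (hc : c ∈ reducedConj M X) (h : PosLE M g c) : g⁻¹ * c ∈ reducedConj M X := by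
  rw [mem_reducedConj] at *
  refine ⟨mem_conjPos_of_mul_right (h := g) (by rw [mul_inv_cancel_left]; exact hc.1) hg.1 h.2,
    fun s hs hle => ?_⟩
  obtain ⟨s', hs', e⟩ := (mem_conjPos_iff.1 hg.1).2.1 s hs
  have h1 := (PosLE.mul_left h.1 hle)
  rw [mul_inv_cancel_left, ← e] at h1
  exact hc.2 s' hs' ((PosLE.of_mul_eq (gen_mem_posMon s') h.1 rfl).trans h1)

theorem le_of_le_mul_posMonOn {g u k : Artin M} (hg : g ∈ reducedConj M X)
    (hu : u ∈ posMonOn M X) (hk : k ∈ posMon M) (h : PosLE M g (u * k)) : PosLE M g k := by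
  rw [mem_reducedConj] at hg
  revert h
  refine posMonOn_induction (p := fun u => PosLE M g (u * k) → PosLE M g k) ?_ ?_ hu
  · intro h
    rwa [one_mul] at h
  · intro s hs u hu ih h
    obtain ⟨s', -, e⟩ := (mem_conjPos_iff.1 hg.1).2.2 s hs
    rw [mul_assoc] at h
    have := gen_mul_le hg.1.1 e (hg.2 s hs)
      (PosLE.of_mul_eq (gen_mem_posMon s) (mul_mem (posMonOn_le X hu) hk) rfl) h
    exact ih (this.of_mul_left hg.1.1)

theorem exists_le_garside_pow {g : Artin M} (hg : g ∈ posMon M) :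
    ∃ n : ℕ, PosLE M g ((garside M * garside M) ^ n) := by
  refine posMon_induction (p := fun g => ∃ n : ℕ, PosLE M g ((garside M * garside M) ^ n))
    ⟨0, PosLE.one_le (by simp)⟩ ?_ hg
  rintro s g - ⟨n, hn⟩
  refine ⟨n + 1, ?_⟩
  have h1 := PosLE.mul_left (gen_mem_posMon (M := M) s) hn
  rw [((commute_garside_sq M (gen M s)).pow_right n).eq] at h1
  obtain ⟨c, hc, e⟩ := exists_gen_mul_eq_garside M s
  refine h1.trans ?_
  rw [pow_succ]
  exact PosLE.mul_left hn.right_mem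
    (PosLE.of_mul_eq (gen_mem_posMon s) (mul_mem hc (garside_mem M)) (by rw [← mul_assoc, e]))

variable (M X) in
/-- `Δ_X⁻² Δ²`. -/
noncomputable def twist : Artin M := (delta M X * delta M X)⁻¹ * (garside M * garside M)

theorem twist_eq : twist M X =
    ((delta M X)⁻¹ * garside M) * (garside M * (delta M X)⁻¹) := by
  have h := (commute_garside_sq M (delta M X)⁻¹).eq
  rw [twist, mul_inv_rev, mul_assoc, h]
  group

theorem delta_pow_mul_twist_pow (n : ℕ) : (delta M X * delta M X) ^ n * twist M X ^ n =
    (garside M * garside M) ^ n := by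
  rw [← Commute.mul_pow, twist, mul_inv_cancel_left]
  exact ((Commute.refl _).inv_right).mul_right (commute_garside_sq M _)

variable [Finite B]

theorem delta_univ : delta M Set.univ = garside M := by
  refine (eq_delta_of_forall_le (posMon_eq_posMonOn_univ (M := M) ▸ garside_mem M)
    (PosLE.refl (garside_mem M)) fun z _ => ?_).symm
  obtain ⟨c, hc, e⟩ := exists_gen_mul_eq_garside M z
  exact PosLE.of_mul_eq (gen_mem_posMon z) hc e

theorem twist_mem_posMon : twist M X ∈ posMon M := by
  rw [twist_eq]
  refine mul_mem (delta_le_garside M X).2 ?_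
  rw [← delta_univ]
  exact mul_inv_mem_of_delta_subset (Set.subset_univ X)

theorem not_mul_delta_mul_gen_le {x : B} (hx : x ∈ X) {a c : Artin M} (ha : a ∈ posMon M)
    (hc : c ∈ posMon M) : a * (delta M X * gen M x) * c ≠ garside M := by
  intro h
  have h1 := rev_mem_posMon (gen_le_delta (M := M) hx).1.2
  rw [rev_mul, rev_inv, rev_delta, rev_gen] at h1
  apply garside_squarefree M (mul_mem ha h1) hc x
  rw [← h]
  group

theorem twist_mem_reducedConj : twist M X ∈ reducedConj M X := by
  have hcomm : ∀ x ∈ X, Commute (gen M x) (twist M X) := by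
    intro x hx
    obtain ⟨x', -, e⟩ := exists_gen_mul_delta (M := M) hx
    refine Commute.mul_right (Commute.inv_right ?_) (commute_garside_sq M _)
    rw [commute_iff_eq, ← mul_assoc, e, mul_assoc, gen_delta_comm e, mul_assoc]
  rw [mem_reducedConj, mem_conjPos_iff]
  refine ⟨⟨twist_mem_posMon, fun x hx => ⟨x, hx, hcomm x hx⟩, fun x hx => ⟨x, hx, hcomm x hx⟩⟩,
    fun s hs h => ?_⟩
  obtain ⟨x, hx, e⟩ := exists_delta_mul_gen (M := M) hs
  have e' := gen_delta_comm e
  have hq := (delta_le_garside M X).2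
  have hq' : garside M * (delta M X)⁻¹ ∈ posMon M := by
    rw [← delta_univ]
    exact mul_inv_mem_of_delta_subset (Set.subset_univ X)
  have h1 : gen M s * ((delta M X)⁻¹ * garside M) =
      (delta M X)⁻¹ * garside M * gen M (garsidePerm M x) := by
    rw [mul_assoc, ← gen_mul_garside, ← mul_assoc, ← mul_assoc, mul_left_inj,
      mul_inv_eq_iff_eq_mul, mul_assoc, e, inv_mul_cancel_left]
  rw [twist_eq] at h
  have h2 := gen_le_of_le_mul hq hq' h1 (fun hle => ?_) h
  · refine not_mul_delta_mul_gen_le hx h2.2 (one_mem _) ?_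
    rw [mul_one, mul_assoc, inv_mul_eq_iff_eq_mul, ← garside_mul_gen]
    group
  · refine not_mul_delta_mul_gen_le hs (one_mem _) hle.2 ?_
    group

theorem exists_le_twist_pow {g : Artin M} (hg : g ∈ reducedConj M X) {n : ℕ}
    (h : PosLE M g ((garside M * garside M) ^ n)) : PosLE M g (twist M X ^ n) := by
  rw [← delta_pow_mul_twist_pow (X := X)] at h
  exact le_of_le_mul_posMonOn hg (pow_mem (mul_mem (delta_mem M X) (delta_mem M X)) n)
    (pow_mem twist_mem_posMon n) h

theorem exists_common_multiple {g h : Artin M} (hg : g ∈ reducedConj M X)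
    (hh : h ∈ reducedConj M X) :
    ∃ k ∈ reducedConj M X, ∃ l ∈ reducedConj M X, g * k = h * l := by
  obtain ⟨m, hm⟩ := exists_le_garside_pow hg.1.1
  obtain ⟨n, hn⟩ := exists_le_garside_pow hh.1.1
  have hΔ : garside M * garside M ∈ posMon M := mul_mem (garside_mem M) (garside_mem M)
  have hm' := hm.mul_right (pow_mem hΔ n)
  have hn' := hn.mul_right (pow_mem hΔ m)
  rw [← pow_add] at hm' hn'
  rw [add_comm] at hn'
  have hτ := pow_mem (twist_mem_reducedConj (M := M) (X := X)) (m + n)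
  exact ⟨_, inv_mul_mem_reducedConj hg hτ (exists_le_twist_pow hg hm'),
    _, inv_mul_mem_reducedConj hh hτ (exists_le_twist_pow hh hn'), by group⟩

theorem mem_HXset_iff {g : Artin M} :
    g ∈ HXset M X ↔ ∃ g₁ ∈ reducedConj M X, ∃ g₂ ∈ reducedConj M X, g = g₁ * g₂⁻¹ := by
  simp only [HXset, isRibbon_iff]
  constructor
  · rintro ⟨g₁, g₂, h1, h2, h3, h4, e⟩
    exact ⟨g₁, ⟨h1, h2⟩, g₂, ⟨h3, h4⟩, e⟩
  · rintro ⟨g₁, ⟨h1, h2⟩, g₂, ⟨h3, h4⟩, e⟩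
    exact ⟨g₁, g₂, h1, h2, h3, h4, e⟩

end Reduced

/-- **Proposition (Godelle).** In a spherical-type Artin-Tits system, the set `H_X` is a
subgroup of `A_S`. -/
theorem HXset_is_subgroup
    [Finite B] (M : CoxeterMatrix B) (hsph : Finite M.Group) (X : Set B) :
    ∃ H : Subgroup (Artin M), (H : Set (Artin M)) = HXset M X := by
  refine ⟨{ carrier := HXset M X, one_mem' := ?_, mul_mem' := ?_, inv_mem' := ?_ }, rfl⟩
  · intro a b ha hb
    obtain ⟨g₁, hg₁, g₂, hg₂, rfl⟩ := mem_HXset_iff.1 ha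
    obtain ⟨h₁, hh₁, h₂, hh₂, rfl⟩ := mem_HXset_iff.1 hb
    obtain ⟨k, hk, l, hl, e⟩ := exists_common_multiple hg₂ hh₁
    refine mem_HXset_iff.2 ⟨g₁ * k, mul_mem hg₁ hk, h₂ * l, mul_mem hh₂ hl, ?_⟩
    have : h₁ = g₂ * k * l⁻¹ := by rw [e, mul_inv_cancel_right]
    rw [this]
    group
  · exact mem_HXset_iff.2 ⟨1, one_mem _, 1, one_mem _, by simp⟩
  · intro a ha
    obtain ⟨g₁, hg₁, g₂, hg₂, rfl⟩ := mem_HXset_iff.1 ha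
    exact mem_HXset_iff.2 ⟨g₂, hg₂, g₁, hg₁, by simp⟩

end ArtinTitsPaper
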